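/- arXiv:0909.4481 — 2 statements merged into one kernel-verified Lean document; each statement's English description precedes it below -/
import Mathlib

section
/- For every p ∈ (1,∞) there is a constant C depending only on n and p such that for every f ∈ L^p(ℝⁿ) with finite Haar expansion and every choice of signs α^η_I ∈ {−1,+1} (for I ∈ 𝒟 and η ∈ {0,1}ⁿ∖{0}), one has ‖Σ_{I∈𝒟} Σ_{η∈{0,1}ⁿ∖{0}} α^η_I h^η_I ⟨h^η_I, f⟩‖_{L^p(ℝⁿ)} ≤ C ‖f‖_{L^p(ℝⁿ)}; that is, the Haar system {h^η_I : I ∈ 𝒟, η ∈ {0,1}ⁿ∖{0}} is an unconditional basis of L^p(ℝⁿ). -/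
open MeasureTheory

noncomputable section

open Classical in
/-- Classical indicator of a proposition. -/
def indR (P : Prop) : ℝ := if P then 1 else 0

/-- The real sign associated to a boolean. -/
def sgnB (b : Bool) : ℝ := if b then 1 else -1

/-- The `ℓ∞` norm of an integer vector, as a real number. -/
def inorm {n : ℕ} (m : Fin n → ℤ) : ℝ := ‖(fun i => (m i : ℝ) : Fin n → ℝ)‖

/-- The dyadic cube `2^{-k}([0,1)^n + m)` of generation `k` in `ℝ^n` (with the `ℓ∞` metric). -/
def dyadicCube (n : ℕ) (k : ℤ) (m : Fin n → ℤ) : Set (Fin n → ℝ) :=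
  {x | ∀ i, (2:ℝ) ^ (-k) * m i ≤ x i ∧ x i < (2:ℝ) ^ (-k) * (m i + 1)}

/-- The side length `2^{-k}` of a dyadic cube of generation `k`. -/
def sideLen (k : ℤ) : ℝ := (2:ℝ) ^ (-k)

/-- One-dimensional Haar function on the dyadic interval `2^{-k}[m, m+1)`:
the non-cancellative `h⁰` for `η = false`, the cancellative `h¹` for `η = true`. -/
def haar1D (k : ℤ) (m : ℤ) (η : Bool) (t : ℝ) : ℝ :=
  (Real.sqrt ((2:ℝ) ^ (-k)))⁻¹ *
    (if η then
        (Set.Ico ((2:ℝ) ^ (-k) * m) ((2:ℝ) ^ (-k) * (m + 1/2))).indicator 1 t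
          - (Set.Ico ((2:ℝ) ^ (-k) * (m + 1/2)) ((2:ℝ) ^ (-k) * (m + 1))).indicator 1 t
      else (Set.Ico ((2:ℝ) ^ (-k) * m) ((2:ℝ) ^ (-k) * (m + 1))).indicator 1 t)

/-- The Haar function `h^η_I` for the dyadic cube `I` indexed by `(k, m)`. -/
def haarFn (n : ℕ) (k : ℤ) (m : Fin n → ℤ) (η : Fin n → Bool) (x : Fin n → ℝ) : ℝ :=
  ∏ i, haar1D k (m i) (η i) (x i)

/-- The non-cancellative Haar function `h⁰_I = |I|^{-1/2} 1_I`. -/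
def haarZero (n : ℕ) (k : ℤ) (m : Fin n → ℤ) : (Fin n → ℝ) → ℝ :=
  haarFn n k m (fun _ => false)

/-- The pairing `⟨g, f⟩ = ∫ g f dx`. -/
def pairing {n : ℕ} (g f : (Fin n → ℝ) → ℝ) : ℝ := ∫ x, g x * f x

/-- A normalised standard kernel with Hölder exponent `γ` (with respect to the `ℓ∞` metric). -/
structure IsNormalisedKernel (n : ℕ) (γ : ℝ) (K : (Fin n → ℝ) → (Fin n → ℝ) → ℝ) : Prop where
  size : ∀ x y, x ≠ y → |K x y| ≤ dist x y ^ (-(n:ℝ))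
  smooth : ∀ x y h, 2 * ‖h‖ < dist x y →
    |K (x + h) y - K x y| + |K x (y + h) - K x y| ≤ ‖h‖ ^ γ * dist x y ^ (-(n:ℝ) - γ)

/-- The singular integral `Tf(x) = ∫ K(x,y) f(y) dy`. -/
def czIntegral {n : ℕ} (K : (Fin n → ℝ) → (Fin n → ℝ) → ℝ) (f : (Fin n → ℝ) → ℝ)
    (x : Fin n → ℝ) : ℝ := ∫ y, K x y * f y

/-- The truncated singular integral `T_ε f(x) = ∫_{|y-x|>ε} K(x,y) f(y) dy`. -/
def czTrunc {n : ℕ} (K : (Fin n → ℝ) → (Fin n → ℝ) → ℝ) (ε : ℝ) (f : (Fin n → ℝ) → ℝ)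
    (x : Fin n → ℝ) : ℝ := ∫ y in {y | ε < dist x y}, K x y * f y

/-- The dyadic conditional expectation `E_k f`. -/
def dyadicE (n : ℕ) (k : ℤ) (f : (Fin n → ℝ) → ℝ) (x : Fin n → ℝ) : ℝ :=
  (2:ℝ) ^ (k * (n:ℤ)) * ∫ y in dyadicCube n k (fun i => ⌊(2:ℝ) ^ k * x i⌋), f y

/-- The dyadic martingale difference `D_k f = E_{k+1} f - E_k f`. -/
def dyadicD (n : ℕ) (k : ℤ) (f : (Fin n → ℝ) → ℝ) (x : Fin n → ℝ) : ℝ :=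
  dyadicE n (k+1) f x - dyadicE n k f x

/-- The centre of the dyadic cube indexed by `(k, m)`. -/
def cubeCenter (n : ℕ) (k : ℤ) (m : Fin n → ℤ) : Fin n → ℝ :=
  fun i => (2:ℝ) ^ (-k) * (m i + 1/2)

/-- The concentric `c`-fold expansion of the dyadic cube indexed by `(k, m)`. -/
def expandCube (n : ℕ) (k : ℤ) (m : Fin n → ℤ) (c : ℝ) : Set (Fin n → ℝ) :=
  {x | ∀ i, |x i - cubeCenter n k m i| ≤ c * (2:ℝ) ^ (-k) / 2}

/-- The set `Σ_{f,s} = ⋃_k 9Ω_k`, where `Ω_k` is the union of the cubes `I ∈ 𝒟_k` on which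
`D_{k+s} f` is not a.e. zero. -/
def SigmaSet (n : ℕ) (f : (Fin n → ℝ) → ℝ) (s : ℕ) : Set (Fin n → ℝ) :=
  ⋃ (k : ℤ) (m : Fin n → ℤ)
    (_ : ¬ (∀ᵐ x ∂(volume.restrict (dyadicCube n k m)), dyadicD n (k + (s:ℤ)) f x = 0)),
      expandCube n k m 9

/-- The (measure-theoretic) support of a measurable function: the complement of the union of
all balls on which the function vanishes a.e. -/
def suppAE {n : ℕ} (f : (Fin n → ℝ) → ℝ) : Set (Fin n → ℝ) :=
  {x | ∀ r > 0, ¬ (∀ᵐ y ∂(volume.restrict (Metric.ball x r)), f y = 0)}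

/-- The axis-parallel closed cube with centre `c` and side length `ρ`. -/
def cube (n : ℕ) (c : Fin n → ℝ) (ρ : ℝ) : Set (Fin n → ℝ) :=
  {x | ∀ i, |x i - c i| ≤ ρ / 2}

/-- The index of the `s`-th dyadic ancestor `I^{(s)}` of the cube indexed by `(k, m)`
(the ancestor is the cube indexed by `(k - s, ancestorIdx s m)`). -/
def ancestorIdx {n : ℕ} (s : ℕ) (m : Fin n → ℤ) : Fin n → ℤ :=
  fun i => Int.fdiv (m i) (2 ^ s)

/-- The distance between two sets (in the ambient metric). -/
def setDist {α : Type*} [PseudoMetricSpace α] (A B : Set α) : ℝ :=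
  sInf (Set.image2 dist A B)

section Bellman

/-- `(A, B)` is a supergradient of `U` at every point, in all directions `(h, k)`
with `|k| ≤ |h|`. -/
def IsZigzagConcave (U A B : ℝ → ℝ → ℝ) : Prop :=
  ∀ x y h k, |k| ≤ |h| → U (x + h) (y + k) ≤ U x y + A x y * h + B x y * k

lemma supergradient_glue {U A B : ℝ → ℝ → ℝ} {x y h k t : ℝ} (ht0 : 0 < t) (ht1 : t < 1)
    (h₁ : U (x + t * h) (y + t * k) ≤ U x y + A x y * (t * h) + B x y * (t * k))
    (h₂ : U x y ≤ U (x + t * h) (y + t * k) + A (x + t * h) (y + t * k) * (-(t * h))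
      + B (x + t * h) (y + t * k) * (-(t * k)))
    (h₃ : U (x + h) (y + k) ≤ U (x + t * h) (y + t * k)
      + A (x + t * h) (y + t * k) * ((1 - t) * h) + B (x + t * h) (y + t * k) * ((1 - t) * k)) :
    U (x + h) (y + k) ≤ U x y + A x y * h + B x y * k := by
  set A' := A (x + t * h) (y + t * k)
  set B' := B (x + t * h) (y + t * k)
  have hslope : A' * h + B' * k ≤ A x y * h + B x y * k := by
    refine le_of_mul_le_mul_left ?_ ht0
    linarith
  have := mul_le_mul_of_nonneg_left hslope (sub_nonneg.2 ht1.le)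
  linarith

/-- A zigzag concave function on the closed first quadrant extends evenly to the plane, provided
its normal derivatives on the axes are nonpositive. -/
lemma isZigzagConcave_even {u A B : ℝ → ℝ → ℝ}
    (hu : ∀ x y X Y, 0 ≤ x → 0 ≤ y → 0 ≤ X → 0 ≤ Y → |Y - y| ≤ |X - x| →
      u X Y ≤ u x y + A x y * (X - x) + B x y * (Y - y))
    (hA : ∀ y, 0 ≤ y → A 0 y ≤ 0) (hB : ∀ x, 0 ≤ x → B x 0 ≤ 0) :
    IsZigzagConcave (fun x y => u |x| |y|) (fun x y => SignType.sign x * A |x| |y|)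
      (fun x y => SignType.sign y * B |x| |y|) := by
  have abs_sub_same : ∀ x h : ℝ, 0 ≤ x * (x + h) → |(|x + h| - |x|)| = |h| := by
    intro x h hx
    rcases lt_trichotomy x 0 with hx0 | rfl | hx0
    · have : x + h ≤ 0 := by nlinarith
      rw [abs_of_neg hx0, abs_of_nonpos this, ← abs_neg]
      congr 1; ring
    · simp
    · have : 0 ≤ x + h := by nlinarith
      rw [abs_of_pos hx0, abs_of_nonneg this]
      congr 1; ring
  have sign_le : ∀ x h a : ℝ, 0 ≤ x * (x + h) → (x = 0 → a ≤ 0) →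
      a * (|x + h| - |x|) ≤ SignType.sign x * a * h := by
    intro x h a hx ha
    rcases lt_trichotomy x 0 with hx0 | rfl | hx0
    · have : x + h ≤ 0 := by nlinarith
      rw [abs_of_neg hx0, abs_of_nonpos this, sign_neg hx0]
      simp only [SignType.coe_neg, SignType.coe_one]
      linarith
    · have := ha rfl
      simp only [zero_add, abs_zero, sub_zero, sign_zero, SignType.coe_zero, zero_mul]
      exact mul_nonpos_of_nonpos_of_nonneg this (abs_nonneg h)
    · have : 0 ≤ x + h := by nlinarith
      rw [abs_of_pos hx0, abs_of_nonneg this, sign_pos hx0]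
      simp only [SignType.coe_one]
      linarith
  have same : ∀ x y h k : ℝ, |k| ≤ |h| → 0 ≤ x * (x + h) → 0 ≤ y * (y + k) →
      u |x + h| |y + k| ≤ u |x| |y| + SignType.sign x * A |x| |y| * h
        + SignType.sign y * B |x| |y| * k := by
    intro x y h k hk hx hy
    have h1 := hu |x| |y| |x + h| |y + k| (abs_nonneg _) (abs_nonneg _) (abs_nonneg _)
      (abs_nonneg _) (by rwa [abs_sub_same x h hx, abs_sub_same y k hy])
    have h2 := sign_le x h (A |x| |y|) hx (by rintro rfl; simpa using hA _ (abs_nonneg y))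
    have h3 := sign_le y k (B |x| |y|) hy (by rintro rfl; simpa using hB _ (abs_nonneg x))
    linarith
  have scale : ∀ {h k : ℝ} (c : ℝ), |k| ≤ |h| → |c * k| ≤ |c * h| := fun c hk => by
    rw [abs_mul, abs_mul]; exact mul_le_mul_of_nonneg_left hk (abs_nonneg c)
  have cross : ∀ x h : ℝ, x * (x + h) < 0 →
      ∃ t, 0 < t ∧ t < 1 ∧ x + t * h = 0 := by
    intro x h hx
    have hh : h ≠ 0 := by rintro rfl; nlinarith [mul_self_nonneg x]
    refine ⟨-x / h, ?_, ?_, by field_simp; ring⟩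
    · rcases lt_or_gt_of_ne hh with h0 | h0
      · exact div_pos_of_neg_of_neg (by nlinarith) h0
      · exact div_pos (by nlinarith) h0
    · rcases lt_or_gt_of_ne hh with h0 | h0
      · rw [div_lt_one_of_neg h0]; nlinarith
      · rw [div_lt_one h0]; nlinarith
  have half : ∀ x y h k : ℝ, |k| ≤ |h| → 0 ≤ y * (y + k) →
      u |x + h| |y + k| ≤ u |x| |y| + SignType.sign x * A |x| |y| * h
        + SignType.sign y * B |x| |y| * k := by
    intro x y h k hk hy
    rcases le_or_gt 0 (x * (x + h)) with hx | hx
    · exact same x y h k hk hx hy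
    obtain ⟨t, ht0, ht1, htx⟩ := cross x h hx
    have hyt : 0 ≤ y * (y + t * k) := by nlinarith [mul_self_nonneg y]
    have hyt' : 0 ≤ (y + t * k) * (y + k) := by
      have : (y + t * k) * (y + k) = (1 - t) * (y * (y + k)) + t * ((y + k) * (y + k)) := by ring
      rw [this]
      exact add_nonneg (mul_nonneg (by linarith) hy) (mul_nonneg ht0.le (mul_self_nonneg _))
    refine supergradient_glue (U := fun x y => u |x| |y|)
      (A := fun x y => SignType.sign x * A |x| |y|)
      (B := fun x y => SignType.sign y * B |x| |y|) ht0 ht1 ?_ ?_ ?_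
    · exact same x y (t * h) (t * k) (scale t hk) (by simp [htx]) hyt
    · have := same (x + t * h) (y + t * k) (-(t * h)) (-(t * k)) (by simpa using scale t hk)
        (by simp [htx]) (by simpa [mul_comm] using hyt)
      simpa using this
    · have := same (x + t * h) (y + t * k) ((1 - t) * h) ((1 - t) * k) (scale _ hk)
        (by simp [htx]) (by convert hyt' using 2; ring)
      convert this using 3 <;> ring_nf
  intro x y h k hk
  rcases le_or_gt 0 (y * (y + k)) with hy | hy
  · exact half x y h k hk hy
  obtain ⟨t, ht0, ht1, hty⟩ := cross y k hy
  refine supergradient_glue (U := fun x y => u |x| |y|)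
      (A := fun x y => SignType.sign x * A |x| |y|)
      (B := fun x y => SignType.sign y * B |x| |y|) ht0 ht1 ?_ ?_ ?_
  · exact half x y (t * h) (t * k) (scale t hk) (by simp [hty])
  · have := half (x + t * h) (y + t * k) (-(t * h)) (-(t * k)) (by simpa using scale t hk)
      (by simp [hty])
    simpa using this
  · have := half (x + t * h) (y + t * k) ((1 - t) * h) ((1 - t) * k) (scale _ hk)
      (by simp [hty])
    convert this using 3 <;> ring_nf

lemma rpow_tangent_le {q s S : ℝ} (hq : 1 ≤ q) (hs : 0 < s) (hS : 0 ≤ S) :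
    s ^ q + q * s ^ (q - 1) * (S - s) ≤ S ^ q := by
  have h := one_add_mul_self_le_rpow_one_add (s := S / s - 1)
    (by have := div_nonneg hS hs.le; linarith) hq
  have hsq : 0 < s ^ q := Real.rpow_pos_of_pos hs q
  rw [add_sub_cancel, Real.div_rpow hS hs.le, le_div_iff₀ hsq] at h
  rw [Real.rpow_sub_one hs.ne']
  refine le_trans (le_of_eq ?_) h
  field_simp

lemma rpow_le_tangent {q s S : ℝ} (hq0 : 0 ≤ q) (hq : q ≤ 1) (hs : 0 < s) (hS : 0 ≤ S) :
    S ^ q ≤ s ^ q + q * s ^ (q - 1) * (S - s) := by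
  have h := rpow_one_add_le_one_add_mul_self (s := S / s - 1)
    (by have := div_nonneg hS hs.le; linarith) hq0 hq
  have hsq : 0 < s ^ q := Real.rpow_pos_of_pos hs q
  rw [add_sub_cancel, Real.div_rpow hS hs.le, div_le_iff₀ hsq] at h
  rw [Real.rpow_sub_one hs.ne']
  refine h.trans (le_of_eq ?_)
  field_simp

lemma hasDerivAt_trapezoid {p s t : ℝ} (ht : 0 < t) :
    HasDerivAt (fun S => p / 2 * (S - s) * (S ^ (p - 1) + s ^ (p - 1)) - S ^ p)
      (p / 2 * (s ^ (p - 1) - (t ^ (p - 1) + (p - 1) * t ^ (p - 1 - 1) * (s - t)))) t := by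
  have h1 := Real.hasDerivAt_rpow_const (p := p - 1) (Or.inl ht.ne')
  have h2 := Real.hasDerivAt_rpow_const (p := p) (Or.inl ht.ne')
  refine HasDerivAt.congr_deriv (((((hasDerivAt_id t).sub_const s).const_mul (p / 2)).mul
    (h1.add_const (s ^ (p - 1)))).sub h2) ?_
  simp only [id]
  ring

lemma rpow_sub_le_trapezoid {p s S : ℝ} (hp : 2 ≤ p) (hs : 0 < s) (hS : s ≤ S) :
    S ^ p - s ^ p ≤ p / 2 * (S - s) * (S ^ (p - 1) + s ^ (p - 1)) := by
  have hmono : MonotoneOn (fun S => p / 2 * (S - s) * (S ^ (p - 1) + s ^ (p - 1)) - S ^ p)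
      (Set.Ici s) := by
    refine monotoneOn_of_hasDerivWithinAt_nonneg (convex_Ici s)
      (fun t ht => (hasDerivAt_trapezoid (hs.trans_le ht)).continuousAt.continuousWithinAt)
      (fun t ht => (hasDerivAt_trapezoid (hs.trans_le (interior_subset ht))).hasDerivWithinAt) ?_
    intro t ht
    have := rpow_tangent_le (q := p - 1) (by linarith) (hs.trans_le (interior_subset ht)) hs.le
    exact mul_nonneg (by linarith) (by linarith)
  have := hmono (Set.self_mem_Ici) hS hS
  simp only [sub_self, mul_zero, zero_mul, zero_sub] at this
  linarith

lemma trapezoid_le_rpow_sub {p s S : ℝ} (hp1 : 1 < p) (hp : p ≤ 2) (hs : 0 < s) (hS : s ≤ S) :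
    p / 2 * (S - s) * (S ^ (p - 1) + s ^ (p - 1)) ≤ S ^ p - s ^ p := by
  have hanti : AntitoneOn (fun S => p / 2 * (S - s) * (S ^ (p - 1) + s ^ (p - 1)) - S ^ p)
      (Set.Ici s) := by
    refine antitoneOn_of_hasDerivWithinAt_nonpos (convex_Ici s)
      (fun t ht => (hasDerivAt_trapezoid (hs.trans_le ht)).continuousAt.continuousWithinAt)
      (fun t ht => (hasDerivAt_trapezoid (hs.trans_le (interior_subset ht))).hasDerivWithinAt) ?_
    intro t ht
    have := rpow_le_tangent (q := p - 1) (by linarith) (by linarith)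
      (hs.trans_le (interior_subset ht)) hs.le
    exact mul_nonpos_of_nonneg_of_nonpos (by linarith) (by linarith)
  have := hanti (Set.self_mem_Ici) hS hS
  simp only [sub_self, mul_zero, zero_mul, zero_sub] at this
  linarith

lemma hasDerivAt_taylor_two {p s t : ℝ} (hp : 1 < p) :
    HasDerivAt (fun S => p * s ^ (p - 1) * (S - s)
        + p * (p - 1) / 2 * s ^ (p - 1 - 1) * (S - s) ^ 2 - S ^ p)
      (p * (s ^ (p - 1) + (p - 1) * s ^ (p - 1 - 1) * (t - s) - t ^ (p - 1))) t := by
  have h2 := Real.hasDerivAt_rpow_const (x := t) (p := p) (Or.inr hp.le)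
  have h1 := (hasDerivAt_id t).sub_const s
  refine HasDerivAt.congr_deriv (((h1.const_mul (p * s ^ (p - 1))).add
    ((h1.pow 2).const_mul (p * (p - 1) / 2 * s ^ (p - 1 - 1)))).sub h2) ?_
  simp only [id, Nat.cast_ofNat]
  ring

lemma rpow_le_taylor_two {p s S : ℝ} (hp : 2 ≤ p) (hs : 0 < s) (hS0 : 0 ≤ S) (hS : S ≤ s) :
    S ^ p ≤ s ^ p + p * s ^ (p - 1) * (S - s)
      + p * (p - 1) / 2 * s ^ (p - 1 - 1) * (S - s) ^ 2 := by
  have hanti : AntitoneOn (fun S => p * s ^ (p - 1) * (S - s)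
        + p * (p - 1) / 2 * s ^ (p - 1 - 1) * (S - s) ^ 2 - S ^ p) (Set.Icc 0 s) := by
    refine antitoneOn_of_hasDerivWithinAt_nonpos (convex_Icc 0 s)
      (fun t ht => (hasDerivAt_taylor_two (by linarith)).continuousAt.continuousWithinAt)
      (fun t ht => (hasDerivAt_taylor_two (by linarith)).hasDerivWithinAt) ?_
    intro t ht
    have := rpow_tangent_le (q := p - 1) (by linarith) hs (interior_subset ht).1
    exact mul_nonpos_of_nonneg_of_nonpos (by linarith) (by linarith)
  have := hanti ⟨hS0, hS⟩ (Set.right_mem_Icc.2 hs.le) hS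
  simp only [sub_self, mul_zero, zero_sub, ne_eq, OfNat.ofNat_ne_zero, not_false_eq_true,
    zero_pow, add_zero] at this
  linarith

lemma taylor_two_le_rpow {p s S : ℝ} (hp1 : 1 < p) (hp : p ≤ 2) (hs : 0 < s) (hS0 : 0 ≤ S)
    (hS : S ≤ s) :
    s ^ p + p * s ^ (p - 1) * (S - s)
      + p * (p - 1) / 2 * s ^ (p - 1 - 1) * (S - s) ^ 2 ≤ S ^ p := by
  have hmono : MonotoneOn (fun S => p * s ^ (p - 1) * (S - s)
        + p * (p - 1) / 2 * s ^ (p - 1 - 1) * (S - s) ^ 2 - S ^ p) (Set.Icc 0 s) := by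
    refine monotoneOn_of_hasDerivWithinAt_nonneg (convex_Icc 0 s)
      (fun t ht => (hasDerivAt_taylor_two hp1).continuousAt.continuousWithinAt)
      (fun t ht => (hasDerivAt_taylor_two hp1).hasDerivWithinAt) ?_
    intro t ht
    have := rpow_le_tangent (q := p - 1) (by linarith) (by linarith) hs (interior_subset ht).1
    exact mul_nonneg (by linarith) (by linarith)
  have := hmono ⟨hS0, hS⟩ (Set.right_mem_Icc.2 hs.le) hS
  simp only [sub_self, mul_zero, zero_sub, ne_eq, OfNat.ofNat_ne_zero, not_false_eq_true,
    zero_pow, add_zero] at this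
  linarith

lemma rpow_eq_rpow_sub_one_mul {p s : ℝ} (hp : 1 < p) (hs : 0 ≤ s) : s ^ p = s ^ (p - 1) * s := by
  rw [Real.rpow_sub_one' hs (by linarith)]
  rcases hs.eq_or_lt with rfl | hs
  · simp [Real.zero_rpow (by linarith : p ≠ 0)]
  · field_simp

/-- Supergradient inequality for Burkholder's function in the first quadrant, `2 ≤ p`. -/
lemma burkholder_quadrant_of_two_le {p x y X Y : ℝ} (hp : 2 ≤ p) (hx : 0 ≤ x) (hy : 0 ≤ y)
    (hX : 0 ≤ X) (hY : 0 ≤ Y) (hXY : |Y - y| ≤ |X - x|) :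
    (Y - (p - 1) * X) * (X + Y) ^ (p - 1) ≤ (y - (p - 1) * x) * (x + y) ^ (p - 1)
      + -(p * (p - 1) * x * (x + y) ^ (p - 1 - 1)) * (X - x)
      + (p * (x + y) ^ (p - 1) - p * (p - 1) * x * (x + y) ^ (p - 1 - 1)) * (Y - y) := by
  rcases (add_nonneg hx hy).eq_or_lt with hs | hs
  · obtain rfl : x = 0 := by linarith
    obtain rfl : y = 0 := by linarith
    have : (0:ℝ) ^ (p - 1) = 0 := Real.zero_rpow (by linarith)
    simp only [sub_zero, abs_of_nonneg hX, abs_of_nonneg hY] at hXY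
    simp only [add_zero, this, mul_zero, zero_mul, sub_zero, neg_zero]
    exact mul_nonpos_of_nonpos_of_nonneg (by nlinarith)
      (Real.rpow_nonneg (by linarith) _)
  have hsq := sq_le_sq.2 hXY
  obtain ⟨s, rfl⟩ : ∃ s, y = s - x := ⟨x + y, by ring⟩
  obtain ⟨S, rfl⟩ : ∃ S, Y = S - X := ⟨X + Y, by ring⟩
  simp only [add_sub_cancel] at hs ⊢
  have hS : 0 ≤ S := by linarith
  have e1 := rpow_eq_rpow_sub_one_mul (p := p) (by linarith) hs.le
  have e2 := rpow_eq_rpow_sub_one_mul (p := p) (by linarith) hS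
  have tan := rpow_tangent_le (q := p - 1) (by linarith) hs hS
  have hdir : 0 ≤ (S - s) * (2 * (X - x) - (S - s)) := by nlinarith
  rcases lt_trichotomy s S with hlt | rfl | hlt
  · have trap := rpow_sub_le_trapezoid hp hs hlt.le
    have hXx : 0 ≤ 2 * (X - x) - (S - s) := nonneg_of_mul_nonneg_right hdir (by linarith)
    have hmono : s ^ (p - 1) ≤ S ^ (p - 1) := Real.rpow_le_rpow hs.le hlt.le (by linarith)
    have h1 := mul_nonneg (mul_nonneg (by linarith : 0 ≤ p) hx) (sub_nonneg.2 tan)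
    have h2 := mul_nonneg (mul_nonneg (by linarith : 0 ≤ p) hXx) (sub_nonneg.2 hmono)
    rw [e1, e2] at trap
    linarith
  · linarith
  · have tay := rpow_le_taylor_two hp hs hS hlt.le
    have hw := Real.rpow_nonneg hs.le (p - 1 - 1)
    have h1 := mul_nonneg (mul_nonneg (by linarith : 0 ≤ p) hX) (sub_nonneg.2 tan)
    have h2 := mul_nonneg (mul_nonneg (mul_nonneg (by linarith : 0 ≤ p)
      (by linarith : 0 ≤ p - 1)) hw) hdir
    rw [e1, e2] at tay
    linarith

/-- Supergradient inequality for Burkholder's function in the first quadrant, `1 < p ≤ 2`. -/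
lemma burkholder_quadrant_of_le_two {p x y X Y : ℝ} (hp1 : 1 < p) (hp : p ≤ 2) (hx : 0 ≤ x)
    (hy : 0 ≤ y) (hX : 0 ≤ X) (hY : 0 ≤ Y) (hXY : |Y - y| ≤ |X - x|) :
    ((p - 1) * Y - X) * (X + Y) ^ (p - 1) ≤ ((p - 1) * y - x) * (x + y) ^ (p - 1)
      + (p * (p - 1) * y * (x + y) ^ (p - 1 - 1) - p * (x + y) ^ (p - 1)) * (X - x)
      + p * (p - 1) * y * (x + y) ^ (p - 1 - 1) * (Y - y) := by
  rcases (add_nonneg hx hy).eq_or_lt with hs | hs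
  · obtain rfl : x = 0 := by linarith
    obtain rfl : y = 0 := by linarith
    have : (0:ℝ) ^ (p - 1) = 0 := Real.zero_rpow (by linarith)
    simp only [sub_zero, abs_of_nonneg hX, abs_of_nonneg hY] at hXY
    simp only [add_zero, this, mul_zero, zero_mul, sub_zero]
    exact mul_nonpos_of_nonpos_of_nonneg (by nlinarith)
      (Real.rpow_nonneg (by linarith) _)
  have hsq := sq_le_sq.2 hXY
  obtain ⟨s, rfl⟩ : ∃ s, x = s - y := ⟨x + y, by ring⟩
  obtain ⟨S, rfl⟩ : ∃ S, X = S - Y := ⟨X + Y, by ring⟩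
  simp only [sub_add_cancel] at hs ⊢
  have hS : 0 ≤ S := by linarith
  have e1 := rpow_eq_rpow_sub_one_mul hp1 hs.le
  have e2 := rpow_eq_rpow_sub_one_mul hp1 hS
  have tan := rpow_le_tangent (q := p - 1) (by linarith) (by linarith) hs hS
  have hdir : 0 ≤ (S - s) * ((S - s) - 2 * (Y - y)) := by nlinarith
  rcases lt_trichotomy s S with hlt | rfl | hlt
  · have trap := trapezoid_le_rpow_sub hp1 hp hs hlt.le
    have hYy : 0 ≤ (S - s) - 2 * (Y - y) := nonneg_of_mul_nonneg_right hdir (by linarith)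
    have hmono : s ^ (p - 1) ≤ S ^ (p - 1) := Real.rpow_le_rpow hs.le hlt.le (by linarith)
    have h1 := mul_nonneg (mul_nonneg (by linarith : 0 ≤ p) hy) (sub_nonneg.2 tan)
    have h2 := mul_nonneg (mul_nonneg (by linarith : 0 ≤ p) hYy) (sub_nonneg.2 hmono)
    rw [e1, e2] at trap
    linarith
  · linarith
  · have tay := taylor_two_le_rpow hp1 hp hs hS hlt.le
    have hw := Real.rpow_nonneg hs.le (p - 1 - 1)
    have h1 := mul_nonneg (mul_nonneg (by linarith : 0 ≤ p) hY) (sub_nonneg.2 tan)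
    have h2 := mul_nonneg (mul_nonneg (mul_nonneg (by linarith : 0 ≤ p)
      (by linarith : 0 ≤ p - 1)) hw) hdir
    rw [e1, e2] at tay
    linarith

lemma exists_majorant {p a b : ℝ} (hp : 1 < p) (ha : 0 < a) (hb : 0 < b) :
    ∃ C, 0 < C ∧ ∀ x y : ℝ, 0 ≤ x → 0 ≤ y →
      a / 2 * y ^ p - C * x ^ p ≤ (a * y - b * x) * (x + y) ^ (p - 1) := by
  set L := 2 * b / a
  have hL : 0 < L := by positivity
  refine ⟨b * (1 + L) ^ (p - 1) + a / 2 * L ^ p, by positivity, fun x y hx hy => ?_⟩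
  have e1 := rpow_eq_rpow_sub_one_mul hp hx
  have e2 := rpow_eq_rpow_sub_one_mul hp hy
  rcases le_or_gt (L * x) y with h | h
  · have h' : b * x ≤ a / 2 * y := by
      have : b * x = a / 2 * (L * x) := by simp only [L]; field_simp
      rw [this]; gcongr
    have hle : y ^ (p - 1) ≤ (x + y) ^ (p - 1) :=
      Real.rpow_le_rpow hy (by linarith) (by linarith)
    calc _ ≤ a / 2 * y ^ p := by
          have : 0 ≤ (b * (1 + L) ^ (p - 1) + a / 2 * L ^ p) * x ^ p := by positivity
          linarith
      _ = a / 2 * y * y ^ (p - 1) := by rw [e2]; ring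
      _ ≤ a / 2 * y * (x + y) ^ (p - 1) := by gcongr
      _ ≤ _ := by gcongr; linarith
  · have h1 : y ^ p ≤ L ^ p * x ^ p := by
      rw [← Real.mul_rpow hL.le hx]
      exact Real.rpow_le_rpow hy h.le (by linarith)
    have h2 : (x + y) ^ (p - 1) ≤ (1 + L) ^ (p - 1) * x ^ (p - 1) := by
      rw [← Real.mul_rpow (by linarith) hx]
      exact Real.rpow_le_rpow (by linarith) (by linarith) (by linarith)
    have h3 : b * x * (x + y) ^ (p - 1) ≤ b * (1 + L) ^ (p - 1) * x ^ p := by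
      calc _ ≤ b * x * ((1 + L) ^ (p - 1) * x ^ (p - 1)) := by gcongr
        _ = _ := by rw [e1]; ring
    have h4 : a / 2 * y ^ p ≤ a / 2 * (L ^ p * x ^ p) := by gcongr
    have h5 : 0 ≤ a * y * (x + y) ^ (p - 1) := by positivity
    linarith

/-- Existence of a Burkholder function for exponent `p`. -/
lemma exists_burkholder {p : ℝ} (hp : 1 < p) :
    ∃ (U A B : ℝ → ℝ → ℝ) (c C : ℝ), 0 < c ∧ 0 < C ∧ U 0 0 = 0 ∧ A 0 0 = 0 ∧ B 0 0 = 0 ∧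
      IsZigzagConcave U A B ∧ ∀ x y, c * |y| ^ p - C * |x| ^ p ≤ U x y := by
  rcases le_total 2 p with h2 | h2
  · obtain ⟨C, hC, hmaj⟩ := exists_majorant (b := p - 1) hp one_pos (by linarith)
    refine ⟨_, _, _, 1 / 2, C, by norm_num, hC, ?_, ?_, ?_,
      isZigzagConcave_even (u := fun x y => (y - (p - 1) * x) * (x + y) ^ (p - 1))
        (fun x y X Y hx hy hX hY h => burkholder_quadrant_of_two_le h2 hx hy hX hY h) ?_ ?_, ?_⟩
    · simp
    · simp
    · simp
    · intro y _; simp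
    · intro x hx
      simp only [add_zero]
      rcases hx.eq_or_lt with rfl | hx
      · simp [Real.zero_rpow (by linarith : p - 1 ≠ 0)]
      · have e : x ^ (p - 1) = x ^ (p - 1 - 1) * x := by
          rw [Real.rpow_sub_one hx.ne' (p - 1)]; field_simp
        rw [e]
        have := mul_nonneg (mul_nonneg (by linarith : 0 ≤ p) (by linarith : 0 ≤ p - 2))
          (mul_nonneg (Real.rpow_nonneg hx.le (p - 1 - 1)) hx.le)
        linarith
    · intro x y
      simpa using hmaj |x| |y| (abs_nonneg x) (abs_nonneg y)
  · obtain ⟨C, hC, hmaj⟩ := exists_majorant (a := p - 1) hp (by linarith) one_pos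
    refine ⟨_, _, _, (p - 1) / 2, C, by linarith, hC, ?_, ?_, ?_,
      isZigzagConcave_even (u := fun x y => ((p - 1) * y - x) * (x + y) ^ (p - 1))
        (fun x y X Y hx hy hX hY h => burkholder_quadrant_of_le_two hp h2 hx hy hX hY h) ?_ ?_, ?_⟩
    · simp
    · simp
    · simp
    · intro x hx
      simp only [zero_add]
      rcases hx.eq_or_lt with rfl | hx
      · simp [Real.zero_rpow (by linarith : p - 1 ≠ 0)]
      · have e : x ^ (p - 1) = x ^ (p - 1 - 1) * x := by
          rw [Real.rpow_sub_one hx.ne' (p - 1)]; field_simp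
        rw [e]
        have := mul_nonneg (mul_nonneg (by linarith : 0 ≤ p) (by linarith : 0 ≤ 2 - p))
          (mul_nonneg (Real.rpow_nonneg hx.le (p - 1 - 1)) hx.le)
        linarith
    · intro y _; simp
    · intro x y
      simpa using hmaj |x| |y| (abs_nonneg x) (abs_nonneg y)

end Bellman

section FinSimple

/-- Simple functions supported on a set of finite measure. -/
def IsFinSimple {n : ℕ} (f : (Fin n → ℝ) → ℝ) : Prop :=
  ∃ s : SimpleFunc (Fin n → ℝ) ℝ, s.FinMeasSupp volume ∧ ⇑s = f

namespace IsFinSimple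

variable {n : ℕ} {f g : (Fin n → ℝ) → ℝ}

lemma comp₂ (hf : IsFinSimple f) (hg : IsFinSimple g) {Φ : ℝ → ℝ → ℝ} (h0 : Φ 0 0 = 0) :
    IsFinSimple (fun x => Φ (f x) (g x)) := by
  obtain ⟨s, hs, rfl⟩ := hf
  obtain ⟨t, ht, rfl⟩ := hg
  exact ⟨_, hs.map₂ ht h0, rfl⟩

lemma add (hf : IsFinSimple f) (hg : IsFinSimple g) : IsFinSimple (fun x => f x + g x) :=
  hf.comp₂ hg (Φ := fun a b => a + b) (by simp)

lemma mul (hf : IsFinSimple f) (hg : IsFinSimple g) : IsFinSimple (fun x => f x * g x) :=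
  hf.comp₂ hg (Φ := fun a b => a * b) (by simp)

lemma const_mul (hf : IsFinSimple f) (c : ℝ) : IsFinSimple (fun x => c * f x) :=
  hf.comp₂ hf (Φ := fun a _ => c * a) (by simp)

lemma zero : IsFinSimple (fun _ : Fin n → ℝ => (0 : ℝ)) :=
  ⟨0, by simp [SimpleFunc.finMeasSupp_iff_support], rfl⟩

lemma sum {ι : Type*} {s : Finset ι} {F : ι → (Fin n → ℝ) → ℝ}
    (h : ∀ i ∈ s, IsFinSimple (F i)) : IsFinSimple (fun x => ∑ i ∈ s, F i x) := by
  classical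
  induction s using Finset.induction_on with
  | empty => simpa using zero
  | insert i s hi ih =>
    simp only [Finset.sum_insert hi]
    exact (h i (Finset.mem_insert_self i s)).add
      (ih fun j hj => h j (Finset.mem_insert_of_mem hj))

lemma integrable (hf : IsFinSimple f) : Integrable f := by
  obtain ⟨s, hs, rfl⟩ := hf
  exact hs.integrable

lemma memLp (hf : IsFinSimple f) {p : ℝ} (hp : 0 < p) : MemLp f (ENNReal.ofReal p) := by
  obtain ⟨s, hs, rfl⟩ := hf
  exact (SimpleFunc.memLp_iff_finMeasSupp (by simpa using hp) ENNReal.ofReal_ne_top).2 hs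

end IsFinSimple

end FinSimple

section Haar

lemma floor_two_zpow_mul_eq_iff {k m : ℤ} {t : ℝ} :
    ⌊(2:ℝ) ^ k * t⌋ = m ↔ t ∈ Set.Ico ((2:ℝ) ^ (-k) * m) ((2:ℝ) ^ (-k) * (m + 1)) := by
  have h : (0:ℝ) < 2 ^ k := by positivity
  rw [Int.floor_eq_iff, Set.mem_Ico, zpow_neg, inv_mul_le_iff₀ h, lt_inv_mul_iff₀ h]

lemma floor_two_zpow_mul_of_le {k k' : ℤ} (hk : k ≤ k') (t : ℝ) :
    ⌊(2:ℝ) ^ k * t⌋ = ⌊(2:ℝ) ^ k' * t⌋ / 2 ^ (k' - k).toNat := by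
  have := Int.floor_div_natCast ((2:ℝ) ^ k' * t) (2 ^ (k' - k).toNat)
  push_cast at this
  rw [← this]
  congr 1
  have h2 : (2:ℝ) ^ (k' - k).toNat = 2 ^ (k' - k) := by
    rw [← zpow_natCast, Int.toNat_of_nonneg (by omega)]
  rw [h2, zpow_sub₀ two_ne_zero]
  field_simp

/-- The index of the dyadic cube of generation `k` containing `x`. -/
def cell {n : ℕ} (k : ℤ) (x : Fin n → ℝ) : Fin n → ℤ := fun i => ⌊(2:ℝ) ^ k * x i⌋

lemma cell_eq_of_le {n : ℕ} {k k' : ℤ} (hk : k ≤ k') {x y : Fin n → ℝ}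
    (h : cell k' x = cell k' y) : cell k x = cell k y := by
  funext i
  have := congrFun h i
  simp only [cell] at this ⊢
  rw [floor_two_zpow_mul_of_le hk, floor_two_zpow_mul_of_le hk (y i), this]

lemma exists_cell_eq {n : ℕ} (k : ℤ) (m : Fin n → ℤ) : ∃ x : Fin n → ℝ, cell k x = m := by
  refine ⟨fun i => (2:ℝ) ^ (-k) * m i, funext fun i => ?_⟩
  simp only [cell, zpow_neg]
  rw [mul_inv_cancel_left₀ (by positivity), Int.floor_intCast]

lemma haar1D_false (k m : ℤ) (t : ℝ) :
    haar1D k m false t = (√((2:ℝ) ^ (-k)))⁻¹ * if ⌊(2:ℝ) ^ k * t⌋ = m then 1 else 0 := by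
  simp [haar1D, Set.indicator_apply, floor_two_zpow_mul_eq_iff]

lemma haar1D_true (k m : ℤ) (t : ℝ) :
    haar1D k m true t = (√((2:ℝ) ^ (-k)))⁻¹ *
      ((if ⌊(2:ℝ) ^ (k + 1) * t⌋ = 2 * m then 1 else 0)
        - if ⌊(2:ℝ) ^ (k + 1) * t⌋ = 2 * m + 1 then 1 else 0) := by
  have e : (2:ℝ) ^ (-k) = 2 ^ (-(k + 1)) * 2 := by
    rw [neg_add, zpow_add₀ two_ne_zero, mul_assoc]; norm_num
  simp only [haar1D, Set.indicator_apply, floor_two_zpow_mul_eq_iff, if_true, Pi.one_apply]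
  push_cast
  congr 3
  · rw [e]; ring_nf
  · rw [e]; ring_nf

lemma floor_succ_gen (k : ℤ) (t : ℝ) :
    ⌊(2:ℝ) ^ k * t⌋ = ⌊(2:ℝ) ^ (k + 1) * t⌋ / 2 := by
  simpa using floor_two_zpow_mul_of_le (by omega : k ≤ k + 1) t

lemma haar1D_eq_zero {k m : ℤ} {t : ℝ} (h : ⌊(2:ℝ) ^ k * t⌋ ≠ m) (η : Bool) :
    haar1D k m η t = 0 := by
  cases η
  · simp [haar1D_false, h]
  · rw [floor_succ_gen] at h
    rw [haar1D_true, if_neg (by omega), if_neg (by omega)]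
    simp

lemma abs_haar1D {k m : ℤ} {t : ℝ} (h : ⌊(2:ℝ) ^ k * t⌋ = m) (η : Bool) :
    |haar1D k m η t| = (√((2:ℝ) ^ (-k)))⁻¹ := by
  cases η
  · simp [haar1D_false, h, abs_of_nonneg]
  · rw [floor_succ_gen] at h
    rw [haar1D_true]
    rcases Int.emod_two_eq_zero_or_one ⌊(2:ℝ) ^ (k + 1) * t⌋ with h2 | h2
    · rw [if_pos (by omega), if_neg (by omega)]
      simp [abs_of_nonneg]
    · rw [if_neg (by omega), if_pos (by omega)]
      simp [abs_of_nonneg]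

lemma haar1D_congr {k k' m : ℤ} (hk : k + 1 ≤ k') {t t' : ℝ}
    (h : ⌊(2:ℝ) ^ k' * t⌋ = ⌊(2:ℝ) ^ k' * t'⌋) (η : Bool) : haar1D k m η t = haar1D k m η t' := by
  cases η
  · rw [haar1D_false, haar1D_false, floor_two_zpow_mul_of_le (by omega : k ≤ k'), h,
      floor_two_zpow_mul_of_le (by omega : k ≤ k') t']
  · rw [haar1D_true, haar1D_true, floor_two_zpow_mul_of_le hk, h,
      floor_two_zpow_mul_of_le hk t']

lemma measurable_haar1D (k m : ℤ) (η : Bool) : Measurable (haar1D k m η) := by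
  unfold haar1D
  cases η
  · simp only [Bool.false_eq_true, if_false]
    exact (measurable_one.indicator measurableSet_Ico).const_mul _
  · simp only [if_true]
    exact ((measurable_one.indicator measurableSet_Ico).sub
      (measurable_one.indicator measurableSet_Ico)).const_mul _

lemma finite_range_haar1D (k m : ℤ) (η : Bool) : (Set.range (haar1D k m η)).Finite := by
  refine (Set.toFinite {0, (√((2:ℝ) ^ (-k)))⁻¹, -(√((2:ℝ) ^ (-k)))⁻¹}).subset ?_
  rintro _ ⟨t, rfl⟩
  by_cases h : ⌊(2:ℝ) ^ k * t⌋ = m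
  · right
    exact eq_or_eq_neg_of_abs_eq (abs_haar1D h η)
  · left
    exact haar1D_eq_zero h η

lemma integral_haar1D_true_mul_false (k m : ℤ) :
    ∫ t, haar1D k m true t * haar1D k m false t = 0 := by
  have hpos : (0:ℝ) < 2 ^ (-k) := by positivity
  set r := (√((2:ℝ) ^ (-k)))⁻¹
  have key : ∀ t, haar1D k m true t * haar1D k m false t = r * haar1D k m true t := by
    intro t
    by_cases h : ⌊(2:ℝ) ^ k * t⌋ = m
    · rw [haar1D_false, if_pos h]; ring
    · rw [haar1D_eq_zero h]; simp
  simp only [key]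
  simp only [haar1D, if_true]
  rw [integral_const_mul, integral_const_mul, integral_sub]
  · rw [integral_indicator_one measurableSet_Ico, integral_indicator_one measurableSet_Ico,
      Real.volume_real_Ico_of_le (by gcongr; linarith),
      Real.volume_real_Ico_of_le (by gcongr; linarith)]
    ring
  · exact (integrable_indicator_iff measurableSet_Ico).2 (integrableOn_const (by simp))
  · exact (integrable_indicator_iff measurableSet_Ico).2 (integrableOn_const (by simp))

lemma integral_haar1D_mul_of_ne (k m : ℤ) {η η' : Bool} (h : η ≠ η') :
    ∫ t, haar1D k m η t * haar1D k m η' t = 0 := by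
  cases η <;> cases η'
  · exact absurd rfl h
  · simpa [mul_comm] using integral_haar1D_true_mul_false k m
  · exact integral_haar1D_true_mul_false k m
  · exact absurd rfl h

lemma integral_haar1D_mul_self (k m : ℤ) (η : Bool) :
    ∫ t, haar1D k m η t * haar1D k m η t = 1 := by
  have hpos : (0:ℝ) < 2 ^ (-k) := by positivity
  have key : ∀ t, haar1D k m η t * haar1D k m η t = ((2:ℝ) ^ (-k))⁻¹ *
      (Set.Ico ((2:ℝ) ^ (-k) * m) ((2:ℝ) ^ (-k) * (m + 1))).indicator 1 t := by
    intro t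
    rw [Set.indicator_apply]
    by_cases h : ⌊(2:ℝ) ^ k * t⌋ = m
    · rw [if_pos (floor_two_zpow_mul_eq_iff.1 h), ← abs_mul_abs_self, abs_haar1D h, ← mul_inv,
        Real.mul_self_sqrt hpos.le]
      simp
    · rw [if_neg (fun h' => h (floor_two_zpow_mul_eq_iff.2 h')), haar1D_eq_zero h]
      simp
  simp only [key]
  rw [integral_const_mul, integral_indicator_one measurableSet_Ico,
    Real.volume_real_Ico_of_le (by gcongr; linarith)]
  field_simp
  ring

variable {n : ℕ}

lemma haarFn_eq_zero {k : ℤ} {m : Fin n → ℤ} {x : Fin n → ℝ} (h : cell k x ≠ m)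
    (η : Fin n → Bool) : haarFn n k m η x = 0 := by
  obtain ⟨i, hi⟩ := Function.ne_iff.1 h
  exact Finset.prod_eq_zero (Finset.mem_univ i) (haar1D_eq_zero hi _)

lemma abs_haarFn {k : ℤ} {m : Fin n → ℤ} {x : Fin n → ℝ} (h : cell k x = m)
    (η : Fin n → Bool) : |haarFn n k m η x| = (√((2:ℝ) ^ (-k)))⁻¹ ^ n := by
  rw [haarFn, Finset.abs_prod, Finset.prod_congr rfl fun i _ => abs_haar1D (congrFun h i) (η i)]
  simp

lemma haarFn_congr {k k' : ℤ} (hk : k + 1 ≤ k') (m : Fin n → ℤ) (η : Fin n → Bool)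
    {x y : Fin n → ℝ} (h : cell k' x = cell k' y) : haarFn n k m η x = haarFn n k m η y :=
  Finset.prod_congr rfl fun i _ => haar1D_congr hk (congrFun h i) _

lemma integral_haarFn_mul_of_ne (k : ℤ) (m : Fin n → ℤ) {η η' : Fin n → Bool} (h : η ≠ η') :
    ∫ x, haarFn n k m η x * haarFn n k m η' x = 0 := by
  simp only [haarFn, ← Finset.prod_mul_distrib]
  obtain ⟨i, hi⟩ := Function.ne_iff.1 h
  rw [integral_fintype_prod_volume_eq_prod
    (fun i t => haar1D k (m i) (η i) t * haar1D k (m i) (η' i) t)]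
  exact Finset.prod_eq_zero (Finset.mem_univ i) (integral_haar1D_mul_of_ne k (m i) hi)

lemma integral_haarFn_mul_self (k : ℤ) (m : Fin n → ℤ) (η : Fin n → Bool) :
    ∫ x, haarFn n k m η x * haarFn n k m η x = 1 := by
  simp only [haarFn, ← Finset.prod_mul_distrib]
  rw [integral_fintype_prod_volume_eq_prod
    (fun i t => haar1D k (m i) (η i) t * haar1D k (m i) (η i) t)]
  exact Finset.prod_eq_one fun i _ => integral_haar1D_mul_self k (m i) (η i)

lemma isFinSimple_haarFn (k : ℤ) (m : Fin n → ℤ) (η : Fin n → Bool) :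
    IsFinSimple (haarFn n k m η) := by
  have hmeas : Measurable (haarFn n k m η) :=
    Finset.measurable_prod _ fun i _ => (measurable_haar1D _ _ _).comp (measurable_pi_apply i)
  have hfin : (Set.range (haarFn n k m η)).Finite := by
    refine ((Set.Finite.pi' fun i => finite_range_haar1D k (m i) (η i)).image
      fun v => ∏ i, v i).subset ?_
    rintro _ ⟨x, rfl⟩
    exact ⟨fun i => haar1D k (m i) (η i) (x i), fun i => ⟨x i, rfl⟩, rfl⟩
  refine ⟨⟨haarFn n k m η, fun y => hmeas (measurableSet_singleton y), hfin⟩, ?_, rfl⟩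
  rw [SimpleFunc.finMeasSupp_iff_support]
  have hsub : Function.support (haarFn n k m η) ⊆
      Set.Icc (fun i => (2:ℝ) ^ (-k) * m i) (fun i => (2:ℝ) ^ (-k) * (m i + 1)) := by
    intro x hx
    have hc : cell k x = m := by
      by_contra hc
      exact hx (haarFn_eq_zero hc η)
    have := fun i => floor_two_zpow_mul_eq_iff.1 (congrFun hc i)
    exact ⟨fun i => (this i).1, fun i => (this i).2.le⟩
  exact (measure_mono hsub).trans_lt isCompact_Icc.measure_lt_top

lemma integral_haarFn_eq_zero (k : ℤ) (m : Fin n → ℤ) {η : Fin n → Bool}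
    (hη : η ≠ fun _ => false) : ∫ x, haarFn n k m η x = 0 := by
  have h := integral_haarFn_mul_of_ne k m hη
  have hr : (√((2:ℝ) ^ (-k)))⁻¹ ^ n ≠ 0 := by positivity
  have key : ∀ x, haarFn n k m η x * haarFn n k m (fun _ => false) x
      = (√((2:ℝ) ^ (-k)))⁻¹ ^ n * haarFn n k m η x := by
    intro x
    by_cases hc : cell k x = m
    · have : haarFn n k m (fun _ => false) x = (√((2:ℝ) ^ (-k)))⁻¹ ^ n := by
        rw [← abs_haarFn hc (fun _ => false), abs_of_nonneg]
        refine Finset.prod_nonneg fun i _ => ?_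
        rw [haar1D_false]
        positivity
      rw [this, mul_comm]
    · rw [haarFn_eq_zero hc]; simp
  simp only [key] at h
  rw [integral_const_mul] at h
  exact (mul_eq_zero.1 h).resolve_left hr

/-- If on the cube `(k, m)` the function `φ` depends only on `h^{η₀}`, then `φ` is orthogonal
to every other cancellative Haar function of that cube. -/
lemma integral_mul_haarFn_eq_zero {k : ℤ} {m : Fin n → ℤ} {η η₀ : Fin n → Bool}
    (hη : η ≠ fun _ => false) (hη₀ : η₀ ≠ η) {φ : (Fin n → ℝ) → ℝ} (Ψ : ℝ → ℝ)
    (hφ : ∀ x, cell k x = m → φ x = Ψ (haarFn n k m η₀ x)) :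
    ∫ x, φ x * haarFn n k m η x = 0 := by
  set r := (√((2:ℝ) ^ (-k)))⁻¹ ^ n with hr
  have hr0 : r ≠ 0 := by positivity
  have key : ∀ x, φ x * haarFn n k m η x = (Ψ r + Ψ (-r)) / 2 * haarFn n k m η x
      + (Ψ r - Ψ (-r)) / (2 * r) * (haarFn n k m η₀ x * haarFn n k m η x) := by
    intro x
    by_cases hc : cell k x = m
    · rw [hφ x hc]
      rcases eq_or_eq_neg_of_abs_eq (abs_haarFn hc η₀) with h | h
      · rw [h, ← hr]; field_simp; ring
      · rw [h, ← hr]; field_simp; ring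
    · simp [haarFn_eq_zero hc]
  simp only [key]
  rw [integral_add ((isFinSimple_haarFn k m η).const_mul _).integrable
    (((isFinSimple_haarFn k m η₀).mul (isFinSimple_haarFn k m η)).const_mul _).integrable,
    integral_const_mul, integral_const_mul, integral_haarFn_eq_zero k m hη,
    integral_haarFn_mul_of_ne k m hη₀]
  simp

lemma integral_mul_haarFn_eq_zero_of_const {k : ℤ} {m : Fin n → ℤ} {η : Fin n → Bool}
    (hη : η ≠ fun _ => false) {φ : (Fin n → ℝ) → ℝ} (a : ℝ)
    (hφ : ∀ x, cell k x = m → φ x = a) : ∫ x, φ x * haarFn n k m η x = 0 :=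
  integral_mul_haarFn_eq_zero hη hη.symm (fun _ => a) hφ

lemma integral_haarFn_mul_of_lt {k k' : ℤ} (hk : k < k') (m m' : Fin n → ℤ)
    (η : Fin n → Bool) {η' : Fin n → Bool} (hη' : η' ≠ fun _ => false) :
    ∫ x, haarFn n k m η x * haarFn n k' m' η' x = 0 := by
  obtain ⟨x₀, hx₀⟩ := exists_cell_eq k' m'
  exact integral_mul_haarFn_eq_zero_of_const hη' (haarFn n k m η x₀)
    fun x hx => haarFn_congr hk m η (hx.trans hx₀.symm)

/-- Orthonormality of the cancellative Haar functions. -/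
lemma integral_haarFn_mul_haarFn {q q' : ℤ × (Fin n → ℤ) × (Fin n → Bool)}
    (hq : q.2.2 ≠ fun _ => false) (hq' : q'.2.2 ≠ fun _ => false) :
    ∫ x, haarFn n q.1 q.2.1 q.2.2 x * haarFn n q'.1 q'.2.1 q'.2.2 x = if q = q' then 1 else 0 := by
  obtain ⟨k, m, η⟩ := q
  obtain ⟨k', m', η'⟩ := q'
  simp only at hq hq' ⊢
  split_ifs with h
  · obtain ⟨rfl, rfl, rfl⟩ : k = k' ∧ m = m' ∧ η = η' := by simpa using h
    exact integral_haarFn_mul_self k m η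
  rcases lt_trichotomy k k' with hk | rfl | hk
  · exact integral_haarFn_mul_of_lt hk m m' η hq'
  · by_cases hm : m = m'
    · subst hm
      exact integral_haarFn_mul_of_ne k m (by rintro rfl; exact h rfl)
    · refine integral_eq_zero_of_ae (Filter.Eventually.of_forall fun x => ?_)
      by_cases hc : cell k x = m
      · simp [haarFn_eq_zero (show cell k x ≠ m' by rw [hc]; exact hm)]
      · simp [haarFn_eq_zero hc]
  · simpa [mul_comm] using integral_haarFn_mul_of_lt hk m' m η' hq

end Haar

section Transform

variable {n : ℕ}

/-- The finite Haar expansion with coefficients `c` over the index set `F`. -/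
def haarSum (F : Finset (ℤ × (Fin n → ℤ) × (Fin n → Bool)))
    (c : ℤ × (Fin n → ℤ) × (Fin n → Bool) → ℝ) (x : Fin n → ℝ) : ℝ :=
  ∑ q ∈ F, c q * haarFn n q.1 q.2.1 q.2.2 x

variable {F : Finset (ℤ × (Fin n → ℤ) × (Fin n → Bool))}
  {c d : ℤ × (Fin n → ℤ) × (Fin n → Bool) → ℝ}

lemma isFinSimple_haarSum (F : Finset (ℤ × (Fin n → ℤ) × (Fin n → Bool)))
    (c : ℤ × (Fin n → ℤ) × (Fin n → Bool) → ℝ) : IsFinSimple (haarSum F c) :=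
  IsFinSimple.sum fun _ _ => (isFinSimple_haarFn _ _ _).const_mul _

lemma pairing_haarSum (hF : ∀ q ∈ F, q.2.2 ≠ fun _ => false)
    {q : ℤ × (Fin n → ℤ) × (Fin n → Bool)} (hq : q.2.2 ≠ fun _ => false) :
    pairing (haarFn n q.1 q.2.1 q.2.2) (haarSum F c) = if q ∈ F then c q else 0 := by
  simp only [pairing, haarSum, Finset.mul_sum]
  rw [integral_finsetSum]
  · rw [← Finset.sum_ite_eq F q c]
    refine Finset.sum_congr rfl fun q' hq' => ?_
    simp only [mul_left_comm _ (c q')]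
    rw [integral_const_mul, integral_haarFn_mul_haarFn hq (hF q' hq'), mul_ite, mul_one, mul_zero]
  · exact fun q' _ => ((isFinSimple_haarFn _ _ _).mul
      ((isFinSimple_haarFn _ _ _).const_mul _)).integrable

lemma integral_mul_haarSum_eq_zero {φ : (Fin n → ℝ) → ℝ} (hφ : IsFinSimple φ)
    (h : ∀ q ∈ F, ∫ x, φ x * haarFn n q.1 q.2.1 q.2.2 x = 0) :
    ∫ x, φ x * haarSum F c x = 0 := by
  simp only [haarSum, Finset.mul_sum]
  rw [integral_finsetSum]
  · refine Finset.sum_eq_zero fun q hq => ?_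
    simp only [mul_left_comm _ (c q)]
    rw [integral_const_mul, h q hq, mul_zero]
  · exact fun q' _ => (hφ.mul ((isFinSimple_haarFn _ _ _).const_mul _)).integrable

lemma haarSum_congr {k : ℤ} (hF : ∀ q ∈ F, q.1 < k) {x y : Fin n → ℝ} (h : cell k x = cell k y) :
    haarSum F c x = haarSum F c y :=
  Finset.sum_congr rfl fun q hq => by rw [haarFn_congr (hF q hq) q.2.1 q.2.2 h]

/-- At most one cube of each generation contributes at a given point. -/
lemma haarSum_filter_eq (k : ℤ) (η : Fin n → Bool) (x : Fin n → ℝ) :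
    haarSum (F.filter fun q => q.1 = k ∧ q.2.2 = η) c x =
      (if (k, cell k x, η) ∈ F then c (k, cell k x, η) else 0) * haarFn n k (cell k x) η x := by
  have hz : ∀ q ∈ F.filter (fun q => q.1 = k ∧ q.2.2 = η), q ≠ (k, cell k x, η) →
      c q * haarFn n q.1 q.2.1 q.2.2 x = 0 := by
    rintro ⟨k', m, η'⟩ hq hne
    obtain ⟨-, rfl, rfl⟩ := Finset.mem_filter.1 hq
    have hm : cell k' x ≠ m := by rintro rfl; exact hne rfl
    simp [haarFn_eq_zero hm]
  split_ifs with hmem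
  · exact Finset.sum_eq_single _ hz fun h => absurd (Finset.mem_filter.2 ⟨hmem, rfl, rfl⟩) h
  · rw [zero_mul]
    refine Finset.sum_eq_zero fun q hq => hz q hq ?_
    rintro rfl
    exact hmem (Finset.mem_filter.1 hq).1

lemma haarSum_eq_zero (h : ∀ q ∈ F, c q = 0) : haarSum F c = fun _ => 0 :=
  funext fun _ => Finset.sum_eq_zero fun q hq => by rw [h q hq, zero_mul]

lemma haarSum_filter_lt_succ (F : Finset (ℤ × (Fin n → ℤ) × (Fin n → Bool)))
    (c : ℤ × (Fin n → ℤ) × (Fin n → Bool) → ℝ) (k : ℤ) (η : Fin n → Bool) (x : Fin n → ℝ) :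
    haarSum (F.filter fun q => q.1 < k + 1) c x = haarSum (F.filter fun q => q.1 < k) c x
      + haarSum (F.filter fun q => q.1 = k ∧ q.2.2 = η) c x
      + haarSum (F.filter fun q => q.1 = k ∧ q.2.2 ≠ η) c x := by
  simp only [haarSum, Finset.sum_filter, ← Finset.sum_add_distrib]
  refine Finset.sum_congr rfl fun q _ => ?_
  rcases lt_trichotomy q.1 k with h | h | h
  · simp [h, h.ne, show q.1 < k + 1 by omega]
  · by_cases hη : q.2.2 = η <;> simp [h, hη]
  · simp [h.ne', show ¬ q.1 < k by omega, show ¬ q.1 < k + 1 by omega]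

variable {U A B : ℝ → ℝ → ℝ}

lemma IsZigzagConcave.integral_le (hU : IsZigzagConcave U A B) (hU0 : U 0 0 = 0)
    (hA0 : A 0 0 = 0) (hB0 : B 0 0 = 0) {φ γ δ ε : (Fin n → ℝ) → ℝ} (hφ : IsFinSimple φ)
    (hγ : IsFinSimple γ) (hδ : IsFinSimple δ) (hε : IsFinSimple ε) (hle : ∀ x, |ε x| ≤ |δ x|)
    (hAδ : ∫ x, A (φ x) (γ x) * δ x = 0) (hBε : ∫ x, B (φ x) (γ x) * ε x = 0) :
    ∫ x, U (φ x + δ x) (γ x + ε x) ≤ ∫ x, U (φ x) (γ x) := by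
  have iA := ((hφ.comp₂ hγ hA0).mul hδ).integrable
  have iB := ((hφ.comp₂ hγ hB0).mul hε).integrable
  have iU := (hφ.comp₂ hγ hU0).integrable
  calc _ ≤ ∫ x, (U (φ x) (γ x) + A (φ x) (γ x) * δ x) + B (φ x) (γ x) * ε x :=
        integral_mono ((hφ.add hδ).comp₂ (hγ.add hε) hU0).integrable ((iU.add iA).add iB)
          fun x => hU _ _ _ _ (hle x)
    _ = _ := by
        rw [integral_add (by exact iU.add iA) iB, integral_add iU iA, hAδ, hBε, add_zero, add_zero]

/-- Adding one generation of the Haar expansion does not increase the Burkholder functional. -/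
lemma IsZigzagConcave.integral_haarSum_succ_le (hU : IsZigzagConcave U A B) (hU0 : U 0 0 = 0)
    (hA0 : A 0 0 = 0) (hB0 : B 0 0 = 0) (hF : ∀ q ∈ F, q.2.2 ≠ fun _ => false)
    {η : Fin n → Bool} (hcd : ∀ q ∈ F, |d q| ≤ |c q|) (hd : ∀ q ∈ F, q.2.2 ≠ η → d q = 0)
    (k : ℤ) :
    ∫ x, U (haarSum (F.filter fun q => q.1 < k + 1) c x)
        (haarSum (F.filter fun q => q.1 < k + 1) d x) ≤
      ∫ x, U (haarSum (F.filter fun q => q.1 < k) c x)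
        (haarSum (F.filter fun q => q.1 < k) d x) := by
  simp only [haarSum_filter_lt_succ F _ k η]
  have hz : haarSum (F.filter fun q => q.1 = k ∧ q.2.2 ≠ η) d = fun _ => 0 :=
    haarSum_eq_zero fun q hq => hd q (Finset.mem_filter.1 hq).1 (Finset.mem_filter.1 hq).2.2
  simp only [hz]
  set φ := haarSum (F.filter fun q => q.1 < k) c with hφ
  set γ := haarSum (F.filter fun q => q.1 < k) d with hγ
  set δ := haarSum (F.filter fun q => q.1 = k ∧ q.2.2 = η) c with hδ
  set ε := haarSum (F.filter fun q => q.1 = k ∧ q.2.2 = η) d with hε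
  have sφ : IsFinSimple φ := isFinSimple_haarSum _ _
  have sγ : IsFinSimple γ := isFinSimple_haarSum _ _
  have sδ : IsFinSimple δ := isFinSimple_haarSum _ _
  have sε : IsFinSimple ε := isFinSimple_haarSum _ _
  have cφ : ∀ {x y}, cell k x = cell k y → φ x = φ y :=
    haarSum_congr fun q hq => (Finset.mem_filter.1 hq).2
  have cγ : ∀ {x y}, cell k x = cell k y → γ x = γ y :=
    haarSum_congr fun q hq => (Finset.mem_filter.1 hq).2
  have ortho : ∀ {Φ : ℝ → ℝ → ℝ} {e : ℤ × (Fin n → ℤ) × (Fin n → Bool) → ℝ}, Φ 0 0 = 0 →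
      ∫ x, Φ (φ x) (γ x) * haarSum (F.filter fun q => q.1 = k ∧ q.2.2 = η) e x = 0 := by
    intro Φ e hΦ
    refine integral_mul_haarSum_eq_zero (sφ.comp₂ sγ hΦ) ?_
    rintro ⟨k', m, η'⟩ hq
    obtain ⟨hqF, rfl, rfl⟩ := Finset.mem_filter.1 hq
    obtain ⟨x₀, hx₀⟩ := exists_cell_eq k' m
    refine integral_mul_haarFn_eq_zero_of_const (hF _ hqF) (Φ (φ x₀) (γ x₀)) fun x hx => ?_
    rw [cφ (hx.trans hx₀.symm), cγ (hx.trans hx₀.symm)]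
  have hle : ∀ x, |ε x| ≤ |δ x| := by
    intro x
    rw [hε, hδ, haarSum_filter_eq, haarSum_filter_eq, abs_mul, abs_mul]
    refine mul_le_mul_of_nonneg_right ?_ (abs_nonneg _)
    split_ifs with h
    · exact hcd _ h
    · rfl
  have ortho' : ∫ x, A (φ x + δ x) (γ x + ε x) *
      haarSum (F.filter fun q => q.1 = k ∧ q.2.2 ≠ η) c x = 0 := by
    refine integral_mul_haarSum_eq_zero ((sφ.add sδ).comp₂ (sγ.add sε) hA0) ?_
    rintro ⟨k', m, η'⟩ hq
    obtain ⟨hqF, rfl, hη'⟩ := Finset.mem_filter.1 hq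
    obtain ⟨x₀, hx₀⟩ := exists_cell_eq k' m
    refine integral_mul_haarFn_eq_zero (hF _ hqF) (Ne.symm hη')
      (fun v => A (φ x₀ + (if (k', m, η) ∈ F then c (k', m, η) else 0) * v)
        (γ x₀ + (if (k', m, η) ∈ F then d (k', m, η) else 0) * v)) fun x hx => ?_
    rw [cφ (hx.trans hx₀.symm), cγ (hx.trans hx₀.symm), hδ, hε, haarSum_filter_eq,
      haarSum_filter_eq, hx]
  calc _ ≤ ∫ x, U (φ x + δ x) (γ x + ε x) :=
        hU.integral_le hU0 hA0 hB0 (sφ.add sδ) (sγ.add sε) (isFinSimple_haarSum _ _)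
          IsFinSimple.zero (by simp) ortho' (by simp)
    _ ≤ _ := hU.integral_le hU0 hA0 hB0 sφ sγ sδ sε hle (ortho hA0) (ortho hB0)

lemma IsZigzagConcave.integral_haarSum_nonpos (hU : IsZigzagConcave U A B) (hU0 : U 0 0 = 0)
    (hA0 : A 0 0 = 0) (hB0 : B 0 0 = 0) (hF : ∀ q ∈ F, q.2.2 ≠ fun _ => false)
    {η : Fin n → Bool} (hcd : ∀ q ∈ F, |d q| ≤ |c q|) (hd : ∀ q ∈ F, q.2.2 ≠ η → d q = 0) :
    ∫ x, U (haarSum F c x) (haarSum F d x) ≤ 0 := by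
  obtain ⟨k₀, hk₀⟩ := (F.image Prod.fst).bddBelow
  obtain ⟨k₁, hk₁⟩ := (F.image Prod.fst).bddAbove
  have key : ∀ k, k₀ ≤ k → ∫ x, U (haarSum (F.filter fun q => q.1 < k) c x)
      (haarSum (F.filter fun q => q.1 < k) d x) ≤ 0 := by
    intro k hk
    induction k, hk using Int.leInduction with
    | base =>
      have : F.filter (fun q => q.1 < k₀) = ∅ :=
        Finset.filter_false_of_mem fun q hq =>
          not_lt.2 (hk₀ (Finset.mem_coe.2 (Finset.mem_image_of_mem _ hq)))
      simp [this, haarSum, hU0]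
    | succ k _ ih =>
      exact (hU.integral_haarSum_succ_le hU0 hA0 hB0 hF hcd hd k).trans ih
  have htop : F.filter (fun q => q.1 < max k₀ (k₁ + 1)) = F :=
    Finset.filter_true_of_mem fun q hq => lt_max_of_lt_right
      (Int.lt_add_one_of_le (hk₁ (Finset.mem_coe.2 (Finset.mem_image_of_mem _ hq))))
  simpa only [htop] using key _ (le_max_left k₀ (k₁ + 1))

/-- `L^p` bounds for Haar multipliers acting on a single type `η` of Haar functions. -/
lemma exists_eLpNorm_haarSum_le (n : ℕ) {p : ℝ} (hp : 1 < p) :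
    ∃ C : ℝ, 0 < C ∧ ∀ (F : Finset (ℤ × (Fin n → ℤ) × (Fin n → Bool)))
      (c d : ℤ × (Fin n → ℤ) × (Fin n → Bool) → ℝ) (η : Fin n → Bool),
      (∀ q ∈ F, q.2.2 ≠ fun _ => false) → (∀ q ∈ F, |d q| ≤ |c q|) →
      (∀ q ∈ F, q.2.2 ≠ η → d q = 0) →
      eLpNorm (haarSum F d) (ENNReal.ofReal p) volume ≤
        ENNReal.ofReal C * eLpNorm (haarSum F c) (ENNReal.ofReal p) volume := by
  obtain ⟨U, A, B, a, b, ha, hb, hU0, hA0, hB0, hU, hmaj⟩ := exists_burkholder hp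
  have hp0 : 0 < p := by linarith
  refine ⟨(b / a) ^ p⁻¹, by positivity, fun F c d η hF hcd hd => ?_⟩
  have sc := isFinSimple_haarSum F c
  have sd := isFinSimple_haarSum F d
  have z : (0:ℝ) ^ p = 0 := Real.zero_rpow hp0.ne'
  have ic : Integrable fun x => |haarSum F c x| ^ p :=
    (sc.comp₂ sc (Φ := fun u _ => |u| ^ p) (by simp [z])).integrable
  have idd : Integrable fun x => |haarSum F d x| ^ p :=
    (sd.comp₂ sd (Φ := fun u _ => |u| ^ p) (by simp [z])).integrable
  have hint : a * ∫ x, |haarSum F d x| ^ p ≤ b * ∫ x, |haarSum F c x| ^ p := by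
    rw [← sub_nonpos, ← integral_const_mul, ← integral_const_mul,
      ← integral_sub (idd.const_mul a) (ic.const_mul b)]
    exact (integral_mono ((idd.const_mul a).sub (ic.const_mul b)) (sc.comp₂ sd hU0).integrable
      fun x => hmaj _ _).trans (hU.integral_haarSum_nonpos hU0 hA0 hB0 hF hcd hd)
  have hne : ENNReal.ofReal p ≠ 0 := by simpa using hp0
  rw [(sd.memLp hp0).eLpNorm_eq_integral_rpow_norm hne ENNReal.ofReal_ne_top,
    (sc.memLp hp0).eLpNorm_eq_integral_rpow_norm hne ENNReal.ofReal_ne_top,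
    ENNReal.toReal_ofReal hp0.le, ← ENNReal.ofReal_mul (by positivity)]
  simp only [Real.norm_eq_abs]
  have hc0 : 0 ≤ ∫ x, |haarSum F c x| ^ p := integral_nonneg fun x => by positivity
  have hd0 : 0 ≤ ∫ x, |haarSum F d x| ^ p := integral_nonneg fun x => by positivity
  rw [← Real.mul_rpow (by positivity) hc0]
  refine ENNReal.ofReal_le_ofReal (Real.rpow_le_rpow hd0 ?_ (by positivity))
  rw [div_mul_eq_mul_div, le_div_iff₀ ha, mul_comm]
  exact hint

end Transform

/-- The Haar system is an unconditional basis of `L^p(ℝ^n)`. -/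
theorem statement2 (n : ℕ) (hn : 0 < n) (p : ℝ) (hp : 1 < p) :
    ∃ C : ℝ, 0 < C ∧
      ∀ (F : Finset (ℤ × (Fin n → ℤ) × (Fin n → Bool)))
        (c : ℤ × (Fin n → ℤ) × (Fin n → Bool) → ℝ),
        (∀ q ∈ F, q.2.2 ≠ (fun _ => false)) →
        ∀ f : (Fin n → ℝ) → ℝ,
          (f = fun x => ∑ q ∈ F, c q * haarFn n q.1 q.2.1 q.2.2 x) →
        ∀ G : Finset (ℤ × (Fin n → ℤ) × (Fin n → Bool)),
          (∀ q ∈ G, q.2.2 ≠ (fun _ => false)) →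
        ∀ α : ℤ × (Fin n → ℤ) × (Fin n → Bool) → ℝ, (∀ q, α q = 1 ∨ α q = -1) →
          eLpNorm
              (fun x => ∑ q ∈ G,
                α q * pairing (haarFn n q.1 q.2.1 q.2.2) f * haarFn n q.1 q.2.1 q.2.2 x)
              (ENNReal.ofReal p) volume ≤
            ENNReal.ofReal C * eLpNorm f (ENNReal.ofReal p) volume := by
  classical
  obtain ⟨C, hC, hbound⟩ := exists_eLpNorm_haarSum_le n hp
  refine ⟨Fintype.card (Fin n → Bool) * C, by positivity, ?_⟩
  intro F c hF f hf G hG α hα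
  obtain rfl : f = haarSum F c := hf
  set d : (Fin n → Bool) → ℤ × (Fin n → ℤ) × (Fin n → Bool) → ℝ :=
    fun η q => if q ∈ G ∧ q.2.2 = η then α q * c q else 0 with hd
  have hsum : (fun x => ∑ q ∈ G, α q * pairing (haarFn n q.1 q.2.1 q.2.2) (haarSum F c) *
      haarFn n q.1 q.2.1 q.2.2 x) = ∑ η, haarSum F (d η) := by
    funext x
    simp only [Finset.sum_apply, haarSum]
    rw [Finset.sum_comm]
    simp only [← Finset.sum_mul]
    have h1 : ∀ q, ∑ η, d η q = if q ∈ G then α q * c q else 0 := by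
      intro q
      by_cases hq : q ∈ G <;> simp [hd, hq]
    simp only [h1, ite_mul, zero_mul]
    rw [← Finset.sum_filter, Finset.filter_mem_eq_inter, Finset.inter_comm,
      ← Finset.filter_mem_eq_inter, Finset.sum_filter]
    refine Finset.sum_congr rfl fun q hq => ?_
    rw [pairing_haarSum hF (hG q hq)]
    split_ifs <;> simp
  have hdc : ∀ η, ∀ q ∈ F, |d η q| ≤ |c q| := by
    intro η q _
    simp only [hd]
    split_ifs
    · rcases hα q with h | h <;> simp [h]
    · simp
  rw [hsum]
  calc _ ≤ ∑ η, eLpNorm (haarSum F (d η)) (ENNReal.ofReal p) volume :=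
        eLpNorm_sum_le (fun η _ => (isFinSimple_haarSum F (d η)).integrable.aestronglyMeasurable)
          (by simpa using hp.le)
    _ ≤ ∑ _η : Fin n → Bool, ENNReal.ofReal C *
          eLpNorm (haarSum F c) (ENNReal.ofReal p) volume :=
        Finset.sum_le_sum fun η _ => hbound F c (d η) η hF (hdc η)
          fun q _ hq => if_neg fun h => hq h.2
    _ = _ := by
        rw [Finset.sum_const, Finset.card_univ, nsmul_eq_mul, ← mul_assoc,
          ENNReal.ofReal_mul (by positivity), ENNReal.ofReal_natCast]

end
end

section
/- Let T be a Calderón–Zygmund operator with normalised standard kernel of Hölder exponent γ. There is C depending only on n, γ such that for all dyadic cubes I, J ∈ 𝒟 with ℓ(I) ≤ ℓ(J) and I ∩ J = ∅, and all η ∈ {0,1}ⁿ∖{0}: |⟨h⁰_J, T h^η_I⟩| ≤ C (ℓ(I)/ℓ(J))^{n/2} · B, where B = ℓ(I)^γ ℓ(J)^n dist(I,J)^{−n−γ} if dist(I,J) ≥ ℓ(J); B = ℓ(I)^γ dist(I,∂J)^{−γ} if ℓ(I) ≤ dist(I,J) ≤ ℓ(J); and B = 1 if dist(I,J) ≤ ℓ(I).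 Distances are taken in the ℓ∞ metric. -/
open MeasureTheory

noncomputable section

theorem integrable_comp_inv_smul_sub {E : Type*} [NormedAddCommGroup E] [NormedSpace ℝ E]
    [FiniteDimensional ℝ E] [MeasureSpace E] [BorelSpace E]
    [(volume : Measure E).IsAddHaarMeasure] {f : E → ℝ} (hf : Integrable f) {r : ℝ} (hr : 0 < r)
    (c : E) : Integrable (fun x => f (r⁻¹ • (x - c))) :=
  (hf.comp_smul (inv_ne_zero hr.ne')).comp_sub_right c

theorem integral_comp_inv_smul_sub {E : Type*} [NormedAddCommGroup E] [NormedSpace ℝ E]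
    [FiniteDimensional ℝ E] [MeasureSpace E] [BorelSpace E]
    [(volume : Measure E).IsAddHaarMeasure] (f : E → ℝ) {r : ℝ} (hr : 0 < r) (c : E) :
    ∫ x, f (r⁻¹ • (x - c)) = r ^ (Module.finrank ℝ E : ℝ) * ∫ x, f x := by
  rw [integral_sub_right_eq_self (fun x => f (r⁻¹ • x)) c,
    Measure.integral_comp_inv_smul_of_nonneg _ _ hr.le, smul_eq_mul, Real.rpow_natCast]

/-- Scaled integrable majorants of `dist x c ^ (-s)` away from `c`. -/
theorem exists_majorant_far (E : Type*) [NormedAddCommGroup E] [NormedSpace ℝ E]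
    [FiniteDimensional ℝ E] [MeasureSpace E] [BorelSpace E]
    [(volume : Measure E).IsAddHaarMeasure] {s : ℝ} (hs : (Module.finrank ℝ E : ℝ) < s) :
    ∃ C : ℝ, 0 ≤ C ∧ ∀ r : ℝ, 0 < r → ∀ c : E, ∃ G : E → ℝ, Integrable G ∧ (∀ x, 0 ≤ G x) ∧
      (∀ x, r ≤ dist x c → dist x c ^ (-s) ≤ G x) ∧
      ∫ x, G x ≤ C * r ^ ((Module.finrank ℝ E : ℝ) - s) := by
  have hs0 : 0 < s := lt_of_le_of_lt (Nat.cast_nonneg _) hs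
  have hint : Integrable (fun x : E => (1 + ‖x‖) ^ (-s)) := integrable_one_add_norm hs
  refine ⟨2 ^ s * ∫ x : E, (1 + ‖x‖) ^ (-s), ?_, fun r hr c => ?_⟩
  · have : 0 ≤ ∫ x : E, (1 + ‖x‖) ^ (-s) := integral_nonneg fun x => by positivity
    positivity
  refine ⟨fun x => 2 ^ s * r ^ (-s) * (1 + ‖r⁻¹ • (x - c)‖) ^ (-s),
    (integrable_comp_inv_smul_sub hint hr c).const_mul _, fun x => by positivity,
    fun x hx => ?_, ?_⟩
  · have hx0 : 0 < dist x c := hr.trans_le hx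
    have hbase : r / 2 * (1 + ‖r⁻¹ • (x - c)‖) ≤ dist x c := by
      rw [norm_smul, Real.norm_of_nonneg (inv_nonneg.2 hr.le), ← dist_eq_norm]
      have : r / 2 * (1 + r⁻¹ * dist x c) = (r + dist x c) / 2 := by field_simp
      linarith
    have h1 := Real.rpow_le_rpow_of_nonpos (by positivity) hbase (neg_nonpos.2 hs0.le)
    rw [Real.mul_rpow (by positivity) (by positivity), Real.div_rpow hr.le (by norm_num),
      Real.rpow_neg (by norm_num : (0:ℝ) ≤ 2), div_inv_eq_mul, mul_comm (r ^ (-s))] at h1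
    exact h1
  · rw [integral_const_mul, integral_comp_inv_smul_sub (fun x : E => (1 + ‖x‖) ^ (-s)) hr c,
      sub_eq_add_neg, Real.rpow_add hr]
    exact le_of_eq (by ring)

/-- Scaled integrable majorants of `dist x c ^ (-p)` near `c`. -/
theorem exists_majorant_near (E : Type*) [NormedAddCommGroup E] [NormedSpace ℝ E]
    [FiniteDimensional ℝ E] [MeasureSpace E] [BorelSpace E]
    [(volume : Measure E).IsAddHaarMeasure] (hE : 1 ≤ Module.finrank ℝ E) {p : ℝ}
    (hp : p < Module.finrank ℝ E) :
    ∃ C : ℝ, 0 ≤ C ∧ ∀ r : ℝ, 0 < r → ∀ c : E, ∃ G : E → ℝ, Integrable G ∧ (∀ x, 0 ≤ G x) ∧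
      (∀ x, dist x c < r → dist x c ^ (-p) ≤ G x) ∧
      ∫ x, G x ≤ C * r ^ ((Module.finrank ℝ E : ℝ) - p) := by
  set g : E → ℝ := (Metric.ball 0 1).indicator (fun x => ‖x‖ ^ (-p)) with hg
  have hg0 : ∀ x, 0 ≤ g x := fun x => Set.indicator_nonneg (fun x _ => by positivity) x
  have hint : Integrable g := by
    refine (integrable_indicator_iff measurableSet_ball).2
      (integrableOn_ball_of_norm_le_rpow (C := 1) hE hp (ae_of_all _ fun x => ?_) ?_)
    · rw [Real.norm_of_nonneg (by positivity), one_mul]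
    · exact Measurable.aestronglyMeasurable (by fun_prop)
  refine ⟨∫ x, g x, integral_nonneg hg0, fun r hr c => ?_⟩
  refine ⟨fun x => r ^ (-p) * g (r⁻¹ • (x - c)),
    (integrable_comp_inv_smul_sub hint hr c).const_mul _,
    fun x => mul_nonneg (by positivity) (hg0 _), fun x hx => ?_, ?_⟩
  · have hnorm : ‖r⁻¹ • (x - c)‖ = r⁻¹ * dist x c := by
      rw [norm_smul, Real.norm_of_nonneg (inv_nonneg.2 hr.le), ← dist_eq_norm]
    have hmem : r⁻¹ • (x - c) ∈ Metric.ball (0 : E) 1 := by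
      rw [mem_ball_zero_iff, hnorm, inv_mul_lt_iff₀ hr, mul_one]
      exact hx
    beta_reduce
    rw [hg, Set.indicator_of_mem hmem, hnorm, ← Real.mul_rpow hr.le (by positivity),
      mul_inv_cancel_left₀ hr.ne']
  · rw [integral_const_mul, integral_comp_inv_smul_sub g hr c, sub_eq_add_neg, Real.rpow_add hr]
    exact le_of_eq (by ring)

theorem sideLen_pos (k : ℤ) : 0 < sideLen k := by
  unfold sideLen
  positivity

theorem dyadicCube_eq_pi (n : ℕ) (k : ℤ) (m : Fin n → ℤ) :
    dyadicCube n k m =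
      Set.univ.pi fun i => Set.Ico (sideLen k * m i) (sideLen k * (m i + 1)) := by
  ext x
  simp [dyadicCube, sideLen]

theorem measurableSet_dyadicCube (n : ℕ) (k : ℤ) (m : Fin n → ℤ) :
    MeasurableSet (dyadicCube n k m) := by
  rw [dyadicCube_eq_pi]
  exact MeasurableSet.univ_pi fun i => measurableSet_Ico

theorem volume_dyadicCube (n : ℕ) (k : ℤ) (m : Fin n → ℤ) :
    volume (dyadicCube n k m) = ENNReal.ofReal (sideLen k ^ n) := by
  rw [dyadicCube_eq_pi, Real.volume_pi_Ico, ENNReal.ofReal_pow (sideLen_pos k).le]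
  simp [mul_add]

theorem integrable_indicator_dyadicCube (n : ℕ) (k : ℤ) (m : Fin n → ℤ) (v : ℝ) :
    Integrable ((dyadicCube n k m).indicator fun _ => v) :=
  (integrable_indicator_iff (measurableSet_dyadicCube n k m)).2
    (integrableOn_const (by simp [volume_dyadicCube]))

theorem integral_indicator_dyadicCube (n : ℕ) (k : ℤ) (m : Fin n → ℤ) (v : ℝ) :
    ∫ x, (dyadicCube n k m).indicator (fun _ => v) x = sideLen k ^ n * v := by
  have := sideLen_pos k
  rw [integral_indicator (measurableSet_dyadicCube n k m), setIntegral_const, measureReal_def,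
    volume_dyadicCube, ENNReal.toReal_ofReal (by positivity), smul_eq_mul]

theorem abs_haar1D_le (k m : ℤ) (η : Bool) (t : ℝ) :
    |haar1D k m η t| ≤ (√(sideLen k))⁻¹ ∧
      (t ∉ Set.Ico (sideLen k * m) (sideLen k * (m + 1)) → haar1D k m η t = 0) := by
  have h0 := sideLen_pos k
  have hs : (0:ℝ) ≤ (√(sideLen k))⁻¹ := by positivity
  unfold haar1D
  simp only [show (2:ℝ) ^ (-k) = sideLen k from rfl]
  have h1 : sideLen k * m < sideLen k * (m + 1 / 2) := by nlinarith
  have h2 : sideLen k * (m + 1 / 2) < sideLen k * (m + 1) := by nlinarith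
  constructor
  · rw [abs_mul, abs_of_nonneg hs]
    refine mul_le_of_le_one_right hs ?_
    cases η <;> simp only [Set.indicator, Set.mem_Ico, Pi.one_apply] <;> split_ifs <;>
      first | (exfalso; grind) | norm_num
  · intro ht
    simp only [Set.mem_Ico, not_and_or, not_le, not_lt] at ht
    refine mul_eq_zero_of_right _ ?_
    cases η <;> simp only [Set.indicator, Set.mem_Ico, Pi.one_apply] <;> split_ifs <;>
      first | (exfalso; grind) | norm_num

theorem abs_haarFn_le (n : ℕ) (k : ℤ) (m : Fin n → ℤ) (η : Fin n → Bool) (x : Fin n → ℝ) :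
    |haarFn n k m η x| ≤ (dyadicCube n k m).indicator (fun _ => (√(sideLen k) ^ n)⁻¹) x := by
  unfold haarFn
  by_cases hx : x ∈ dyadicCube n k m
  · rw [Set.indicator_of_mem hx, Finset.abs_prod, ← inv_pow]
    refine (Finset.prod_le_prod (fun i _ => abs_nonneg _)
      fun i _ => (abs_haar1D_le k (m i) (η i) (x i)).1).trans ?_
    simp
  · rw [Set.indicator_of_notMem hx]
    rw [dyadicCube_eq_pi] at hx
    simp only [Set.mem_univ_pi, not_forall] at hx
    obtain ⟨i, hi⟩ := hx
    rw [Finset.prod_eq_zero (Finset.mem_univ i) ((abs_haar1D_le k (m i) (η i) (x i)).2 hi),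
      abs_zero]

theorem integral_haar1D_true (k m : ℤ) : ∫ t, haar1D k m true t = 0 := by
  have h0 : (0:ℝ) < 2 ^ (-k) := by positivity
  simp only [haar1D, if_true]
  rw [integral_const_mul, integral_sub]
  · rw [integral_indicator_one measurableSet_Ico, integral_indicator_one measurableSet_Ico,
      measureReal_def, measureReal_def, Real.volume_Ico, Real.volume_Ico]
    ring_nf
  all_goals
    exact (integrable_indicator_iff measurableSet_Ico).2 (integrableOn_const (by simp))

theorem integral_haarFn (n : ℕ) (k : ℤ) (m : Fin n → ℤ) {η : Fin n → Bool}
    (hη : η ≠ fun _ => false) : ∫ x, haarFn n k m η x = 0 := by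
  obtain ⟨i, hi⟩ := Function.ne_iff.1 hη
  unfold haarFn
  rw [integral_fintype_prod_volume_eq_prod fun i => haar1D k (m i) (η i)]
  refine Finset.prod_eq_zero (Finset.mem_univ i) ?_
  rw [Bool.eq_true_of_not_eq_false hi, integral_haar1D_true]

theorem measurable_haarFn (n : ℕ) (k : ℤ) (m : Fin n → ℤ) (η : Fin n → Bool) :
    Measurable (haarFn n k m η) := by
  have h1 : ∀ i, Measurable (haar1D k (m i) (η i)) := by
    intro i
    unfold haar1D
    cases η i
    · simpa using (measurable_one.indicator measurableSet_Ico).const_mul _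
    · simpa using ((measurable_one.indicator measurableSet_Ico).sub
        (measurable_one.indicator measurableSet_Ico)).const_mul _
  exact Finset.measurable_prod _ fun i _ => (h1 i).comp (measurable_pi_apply i)

theorem integrable_haarFn (n : ℕ) (k : ℤ) (m : Fin n → ℤ) (η : Fin n → Bool) :
    Integrable (haarFn n k m η) :=
  (integrable_indicator_dyadicCube n k m _).mono'
    (measurable_haarFn n k m η).aestronglyMeasurable (ae_of_all _ (abs_haarFn_le n k m η))

theorem cubeCenter_mem (n : ℕ) (k : ℤ) (m : Fin n → ℤ) :
    cubeCenter n k m ∈ dyadicCube n k m := by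
  intro i
  have : (0:ℝ) < 2 ^ (-k) := by positivity
  constructor <;> simp only [cubeCenter] <;> nlinarith

theorem dist_cubeCenter_le {n : ℕ} {k : ℤ} {m : Fin n → ℤ} {y : Fin n → ℝ}
    (hy : y ∈ dyadicCube n k m) : dist y (cubeCenter n k m) ≤ sideLen k / 2 := by
  have h0 := sideLen_pos k
  refine (dist_pi_le_iff (by positivity)).2 fun i => ?_
  obtain ⟨h1, h2⟩ := hy i
  rw [Real.dist_eq, abs_le]
  simp only [cubeCenter, sideLen] at *
  constructor <;> linarith

theorem mem_dyadicCube_of_dist_lt {n : ℕ} {k : ℤ} {m : Fin n → ℤ} {y : Fin n → ℝ}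
    (hy : dist y (cubeCenter n k m) < sideLen k / 2) : y ∈ dyadicCube n k m := by
  intro i
  have h := (dist_le_pi_dist y (cubeCenter n k m) i).trans_lt hy
  rw [Real.dist_eq, abs_lt] at h
  simp only [cubeCenter, sideLen] at *
  constructor <;> linarith

theorem setDist_le_dist {α : Type*} [PseudoMetricSpace α] {A B : Set α} {x y : α} (hx : x ∈ A)
    (hy : y ∈ B) : setDist A B ≤ dist x y :=
  csInf_le ⟨0, by rintro _ ⟨a, -, b, -, rfl⟩; exact dist_nonneg⟩ (Set.mem_image2_of_mem hx hy)

theorem sideLen_lt_dist_cubeCenter {n : ℕ} {k : ℤ} {m : Fin n → ℤ} {J : Set (Fin n → ℝ)}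
    (h : sideLen k ≤ setDist (dyadicCube n k m) J) {x : Fin n → ℝ} (hx : x ∈ J) :
    sideLen k < dist x (cubeCenter n k m) := by
  by_contra! hle
  have h0 := sideLen_pos k
  set c := cubeCenter n k m
  set z := AffineMap.lineMap c x (1 / 4 : ℝ) with hz
  have h1 : dist z c = 1 / 4 * dist x c := by
    rw [hz, dist_lineMap_left, dist_comm c x]; norm_num
  have h2 : dist z x = 3 / 4 * dist x c := by
    rw [hz, dist_lineMap_right, dist_comm c x]; norm_num
  have hzI : z ∈ dyadicCube n k m := mem_dyadicCube_of_dist_lt (by rw [h1]; linarith)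
  have := setDist_le_dist hzI hx
  linarith

theorem exists_mem_frontier_segment {E : Type*} [NormedAddCommGroup E] [NormedSpace ℝ E]
    {J : Set E} {x y : E} (hx : x ∈ J) (hy : y ∉ J) : ∃ z ∈ frontier J, z ∈ segment ℝ y x := by
  by_contra! h
  have hcl : ∀ z ∈ segment ℝ y x, z ∈ closure J → z ∈ interior J := fun z hz hzc => by
    by_contra hi
    exact h z ⟨hzc, hi⟩ hz
  have hx' := hcl x (right_mem_segment ℝ y x) (subset_closure hx)
  have hy' : y ∉ closure J := fun hc => hy (interior_subset (hcl y (left_mem_segment ℝ y x) hc))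
  obtain ⟨z, -, hz1, hz2⟩ := (convex_segment y x).isPreconnected (interior J) (closure J)ᶜ
    isOpen_interior isClosed_closure.isOpen_compl
    (fun z hz => or_iff_not_imp_right.2 fun hn => hcl z hz (not_not.1 hn))
    ⟨x, right_mem_segment ℝ y x, hx'⟩ ⟨y, left_mem_segment ℝ y x, hy'⟩
  exact hz2 (interior_subset_closure hz1)

theorem setDist_frontier_eq {E : Type*} [NormedAddCommGroup E] [NormedSpace ℝ E] {I J : Set E}
    (hI : I.Nonempty) (hJ : J.Nonempty) (hIJ : Disjoint I J) :
    setDist I (frontier J) = setDist I J := by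
  apply le_antisymm
  · refine le_csInf (hI.image2 hJ) ?_
    rintro _ ⟨y, hy, x, hx, rfl⟩
    obtain ⟨z, hzf, hz⟩ := exists_mem_frontier_segment hx (hIJ.notMem_of_mem_left hy)
    refine (setDist_le_dist hy hzf).trans ?_
    rw [← dist_add_dist_of_mem_segment hz]
    exact le_add_of_nonneg_right dist_nonneg
  · obtain ⟨y, hy⟩ := hI
    obtain ⟨x, hx⟩ := hJ
    obtain ⟨z, hzf, -⟩ := exists_mem_frontier_segment hx (hIJ.notMem_of_mem_left hy)
    refine le_csInf ⟨_, y, hy, z, hzf, rfl⟩ ?_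
    rintro _ ⟨y, hy, z, hz, rfl⟩
    refine le_of_forall_pos_le_add fun ε hε => ?_
    obtain ⟨x, hx, hzx⟩ := Metric.mem_closure_iff.1 hz.1 ε hε
    linarith [setDist_le_dist hy hx, dist_triangle y z x]

/-- Two disjoint dyadic cubes are separated by a coordinate hyperplane. -/
theorem exists_separating_hyperplane {n : ℕ} {k k' : ℤ} {m m' : Fin n → ℤ}
    (h : Disjoint (dyadicCube n k m) (dyadicCube n k' m')) :
    ∃ (i : Fin n) (s : ℝ), ∀ y ∈ dyadicCube n k m, ∀ x ∈ dyadicCube n k' m',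
      |x i - s| ≤ |x i - y i| := by
  have h0 := sideLen_pos k
  have h0' := sideLen_pos k'
  obtain ⟨i, hi⟩ : ∃ i, sideLen k * (m i + 1) ≤ sideLen k' * m' i ∨
      sideLen k' * (m' i + 1) ≤ sideLen k * m i := by
    by_contra! hcon
    refine Set.disjoint_left.1 h
      (show (fun i => max (sideLen k * m i) (sideLen k' * m' i)) ∈ _ from
        fun i => ⟨le_max_left _ _, max_lt ?_ (hcon i).1⟩)
      (fun i => ⟨le_max_right _ _, max_lt (hcon i).2 ?_⟩)
    · change sideLen k * _ < sideLen k * _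
      linarith
    · change sideLen k' * _ < sideLen k' * _
      linarith
  rcases hi with hi | hi
  · refine ⟨i, sideLen k * (m i + 1), fun y hy x hx => ?_⟩
    have h1 := (hy i).2
    have h2 := (hx i).1
    change y i < sideLen k * _ at h1
    change sideLen k' * _ ≤ x i at h2
    rw [abs_of_nonneg (by linarith), abs_of_nonneg (by linarith)]
    linarith
  · refine ⟨i, sideLen k * m i, fun y hy x hx => ?_⟩
    have h1 := (hy i).1
    have h2 := (hx i).2
    change sideLen k * _ ≤ y i at h1
    change x i < sideLen k' * _ at h2
    rw [abs_of_nonpos (by linarith), abs_of_nonpos (by linarith)]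
    linarith

/-- Off-diagonal decay of `T h^η_I`, from the cancellation of `h^η_I`. -/
theorem abs_czIntegral_haarFn_le {n : ℕ} {γ : ℝ} (hγ : 0 < γ)
    {K : (Fin n → ℝ) → (Fin n → ℝ) → ℝ} (hK : IsNormalisedKernel n γ K) {k : ℤ}
    {m : Fin n → ℤ} {η : Fin n → Bool} (hη : η ≠ fun _ => false) {x : Fin n → ℝ}
    (hx : sideLen k < dist x (cubeCenter n k m)) :
    |czIntegral K (haarFn n k m η) x| ≤
      √(sideLen k) ^ n * sideLen k ^ γ * dist x (cubeCenter n k m) ^ (-(n:ℝ) - γ) := by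
  have h0 := sideLen_pos k
  set c := cubeCenter n k m with hc
  unfold czIntegral
  by_cases hint : Integrable fun y => K x y * haarFn n k m η y
  swap
  · rw [integral_undef hint, abs_zero]
    positivity
  have heq : ∫ y, K x y * haarFn n k m η y = ∫ y, (K x y - K x c) * haarFn n k m η y := by
    simp only [sub_mul]
    rw [integral_sub hint ((integrable_haarFn n k m η).const_mul _), integral_const_mul,
      integral_haarFn n k m hη, mul_zero, sub_zero]
  rw [heq, ← Real.norm_eq_abs]
  refine (norm_integral_le_of_norm_le (integrable_indicator_dyadicCube n k m
    (sideLen k ^ γ * dist x c ^ (-(n:ℝ) - γ) * (√(sideLen k) ^ n)⁻¹))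
    (ae_of_all _ fun y => ?_)).trans ?_
  · have hh := abs_haarFn_le n k m η y
    rw [norm_mul, Real.norm_eq_abs, Real.norm_eq_abs]
    by_cases hy : y ∈ dyadicCube n k m
    · rw [Set.indicator_of_mem hy] at hh ⊢
      refine mul_le_mul ?_ hh (abs_nonneg _) (by positivity)
      have hd := dist_cubeCenter_le hy
      rw [← hc, dist_eq_norm] at hd
      have hs := hK.smooth x c (y - c) (by linarith)
      rw [add_sub_cancel] at hs
      have h1 : ‖y - c‖ ^ γ ≤ sideLen k ^ γ :=
        Real.rpow_le_rpow (norm_nonneg _) (by linarith) hγ.le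
      have h2 : 0 ≤ dist x c ^ (-(n:ℝ) - γ) := by positivity
      nlinarith [abs_nonneg (K (x + (y - c)) c - K x c)]
    · rw [Set.indicator_of_notMem hy] at hh ⊢
      rw [le_antisymm hh (abs_nonneg _), mul_zero]
  · rw [integral_indicator_dyadicCube]
    have hsq : sideLen k ^ n = √(sideLen k) ^ n * √(sideLen k) ^ n := by
      rw [← mul_pow, Real.mul_self_sqrt h0.le]
    rw [hsq]
    have : √(sideLen k) ^ n ≠ 0 := by positivity
    exact le_of_eq (by field_simp)

/-- The size of `T h^η_I` close to `I`, in terms of the distance to a hyperplane separating the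
point from `I`. -/
theorem exists_abs_czIntegral_haarFn_le {n : ℕ} (hn : 0 < n) :
    ∃ C : ℝ, 0 ≤ C ∧ ∀ (γ : ℝ) (K : (Fin n → ℝ) → (Fin n → ℝ) → ℝ), IsNormalisedKernel n γ K →
      ∀ (k : ℤ) (m : Fin n → ℤ) (η : Fin n → Bool) (x : Fin n → ℝ) (i : Fin n) (s : ℝ),
        dist x (cubeCenter n k m) ≤ sideLen k → x i ≠ s →
        (∀ y ∈ dyadicCube n k m, |x i - s| ≤ |x i - y i|) →
        |czIntegral K (haarFn n k m η) x| ≤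
          C * (√(sideLen k) ^ n)⁻¹ * (2 * sideLen k) ^ (1 / 2 : ℝ) * |x i - s| ^ (-(1 / 2) : ℝ) := by
  obtain ⟨C, hC0, hC⟩ := exists_majorant_near (Fin n → ℝ) (by simpa using Nat.succ_le_of_lt hn)
    (p := n - 1 / 2) (by simp)
  refine ⟨C, hC0, fun γ K hK k m η x i s hx hs hsep => ?_⟩
  have h0 := sideLen_pos k
  obtain ⟨G, hGint, hG0, hGle, hGC⟩ := hC (2 * sideLen k) (by positivity) x
  have hs0 : 0 < |x i - s| := abs_pos.2 (sub_ne_zero.2 hs)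
  unfold czIntegral
  rw [← Real.norm_eq_abs]
  refine (norm_integral_le_of_norm_le
    (hGint.const_mul ((√(sideLen k) ^ n)⁻¹ * |x i - s| ^ (-(1 / 2) : ℝ)))
    (ae_of_all _ fun y => ?_)).trans ?_
  · have hh := abs_haarFn_le n k m η y
    rw [norm_mul, Real.norm_eq_abs, Real.norm_eq_abs]
    by_cases hy : y ∈ dyadicCube n k m
    · rw [Set.indicator_of_mem hy] at hh
      have hdist : |x i - s| ≤ dist x y :=
        (hsep y hy).trans ((Real.dist_eq _ _).symm.le.trans (dist_le_pi_dist x y i))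
      have hxy : 0 < dist x y := hs0.trans_le hdist
      have hyx : dist y x < 2 * sideLen k := by
        have := dist_triangle_right y x (cubeCenter n k m)
        have := dist_cubeCenter_le hy
        linarith
      have h1 : |K x y| ≤ |x i - s| ^ (-(1 / 2) : ℝ) * G y := by
        refine (hK.size x y (dist_pos.1 hxy)).trans ?_
        rw [show -(n:ℝ) = -(1 / 2) + -(n - 1 / 2) by ring, Real.rpow_add hxy]
        have h2 := hGle y hyx
        rw [dist_comm] at h2
        exact mul_le_mul (Real.rpow_le_rpow_of_nonpos hs0 hdist (by norm_num)) h2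
          (by positivity) (by positivity)
      calc |K x y| * |haarFn n k m η y|
          ≤ (|x i - s| ^ (-(1 / 2) : ℝ) * G y) * (√(sideLen k) ^ n)⁻¹ :=
            mul_le_mul h1 hh (abs_nonneg _) ((abs_nonneg _).trans h1)
        _ = _ := by ring
    · rw [Set.indicator_of_notMem hy] at hh
      rw [le_antisymm hh (abs_nonneg _), mul_zero]
      exact mul_nonneg (by positivity) (hG0 y)
  · rw [integral_const_mul]
    have h3 : ((Module.finrank ℝ (Fin n → ℝ) : ℝ) - (n - 1 / 2)) = 1 / 2 := by simp
    rw [h3] at hGC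
    calc _ ≤ ((√(sideLen k) ^ n)⁻¹ * |x i - s| ^ (-(1 / 2) : ℝ)) *
          (C * (2 * sideLen k) ^ (1 / 2 : ℝ)) := by gcongr
      _ = _ := by ring

theorem abs_pairing_haarZero_le {n : ℕ} {k : ℤ} {m : Fin n → ℤ} {F G : (Fin n → ℝ) → ℝ}
    (hG : Integrable G) (hG0 : ∀ x, 0 ≤ G x)
    (hFG : ∀ᵐ x, x ∈ dyadicCube n k m → |F x| ≤ G x) :
    |pairing (haarZero n k m) F| ≤ (√(sideLen k) ^ n)⁻¹ * ∫ x, G x := by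
  unfold pairing
  rw [← Real.norm_eq_abs, ← integral_const_mul]
  refine norm_integral_le_of_norm_le (hG.const_mul _) ?_
  filter_upwards [hFG] with x hx
  have hh := abs_haarFn_le n k m (fun _ => false) x
  rw [norm_mul, Real.norm_eq_abs, Real.norm_eq_abs]
  by_cases hxm : x ∈ dyadicCube n k m
  · rw [Set.indicator_of_mem hxm] at hh
    exact mul_le_mul hh (hx hxm) (abs_nonneg _) (by positivity)
  · rw [Set.indicator_of_notMem hxm] at hh
    rw [haarZero, le_antisymm hh (abs_nonneg _), zero_mul]
    exact mul_nonneg (by positivity) (hG0 x)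

/-- Integrable majorants of `|x i - s| ^ (-1/2)` on a cube of side-length `2 * a`. -/
theorem exists_majorant_hyperplane {n : ℕ} :
    ∃ C : ℝ, 0 ≤ C ∧ ∀ (a : ℝ), 0 < a → ∀ (c : Fin n → ℝ) (i : Fin n) (s : ℝ),
      ∃ G : (Fin n → ℝ) → ℝ, Integrable G ∧ (∀ x, 0 ≤ G x) ∧
        (∀ x, dist x c ≤ a → |x i - s| ≤ a → |x i - s| ^ (-(1 / 2) : ℝ) ≤ G x) ∧
        ∫ x, G x ≤ C * (2 * a) ^ (n - 1) * (2 * a) ^ (1 / 2 : ℝ) := by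
  obtain ⟨C, hC0, hC⟩ := exists_majorant_near ℝ (by simp) (p := 1 / 2) (by norm_num)
  refine ⟨C, hC0, fun a ha c i s => ?_⟩
  obtain ⟨g, hgint, hg0, hgle, hgC⟩ := hC (2 * a) (by positivity) s
  set f : Fin n → ℝ → ℝ := fun j =>
    if j = i then g else (Set.Icc (c j - a) (c j + a)).indicator 1 with hf
  have hfi : f i = g := by simp [hf]
  have hfj : ∀ j, j ≠ i → f j = (Set.Icc (c j - a) (c j + a)).indicator 1 := fun j hj => by
    simp [hf, hj]
  have hf0 : ∀ j t, 0 ≤ f j t := fun j t => by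
    by_cases hj : j = i
    · rw [hj, hfi]; exact hg0 t
    · rw [hfj j hj]; exact Set.indicator_nonneg (fun _ _ => zero_le_one) t
  refine ⟨fun x => ∏ j, f j (x j), Integrable.fintype_prod fun j => ?_,
    fun x => Finset.prod_nonneg fun j _ => hf0 j _, fun x hx hs => ?_, ?_⟩
  · by_cases hj : j = i
    · rw [hj, hfi]; exact hgint
    · rw [hfj j hj]
      exact (integrable_indicator_iff measurableSet_Icc).2 (integrableOn_const (by simp))
  · have hprod : ∏ j ∈ Finset.univ.erase i, f j (x j) = 1 := by
      refine Finset.prod_eq_one fun j hj => ?_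
      rw [hfj j (Finset.ne_of_mem_erase hj)]
      have h1 := (dist_le_pi_dist x c j).trans hx
      rw [Real.dist_eq, abs_le] at h1
      rw [Set.indicator_of_mem (Set.mem_Icc.2 ⟨by linarith, by linarith⟩), Pi.one_apply]
    beta_reduce
    rw [← Finset.mul_prod_erase _ _ (Finset.mem_univ i), hprod, mul_one, hfi]
    have h2 := hgle (x i) (by rw [Real.dist_eq]; linarith)
    rwa [Real.dist_eq] at h2
  · have hprod : ∏ j ∈ Finset.univ.erase i, ∫ t, f j t = (2 * a) ^ (n - 1) := by
      rw [Finset.prod_congr rfl (g := fun _ => 2 * a) fun j hj => ?_]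
      · simp
      · rw [hfj j (Finset.ne_of_mem_erase hj), integral_indicator_one measurableSet_Icc,
          measureReal_def, Real.volume_Icc, ENNReal.toReal_ofReal (by linarith)]
        ring
    rw [integral_fintype_prod_volume_eq_prod f, ← Finset.mul_prod_erase _ _ (Finset.mem_univ i),
      hprod, hfi]
    have h3 : ((Module.finrank ℝ ℝ : ℝ) - 1 / 2) = 1 / 2 := by norm_num
    rw [h3] at hgC
    calc _ ≤ (C * (2 * a) ^ (1 / 2 : ℝ)) * (2 * a) ^ (n - 1) := by gcongr
      _ = _ := by ring

theorem div_rpow_natCast_half {a b : ℝ} (ha : 0 < a) (hb : 0 < b) (n : ℕ) :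
    (a / b) ^ ((n:ℝ) / 2) = √a ^ n * (√b ^ n)⁻¹ := by
  rw [show (n:ℝ) / 2 = 1 / 2 * n by ring, Real.rpow_mul (by positivity), ← Real.sqrt_eq_rpow,
    Real.rpow_natCast, Real.sqrt_div ha.le, div_pow, div_eq_mul_inv]

/-- Lemma 4.3: estimates for the Haar coefficients `⟨h⁰_J, T h^η_I⟩` for disjoint
dyadic cubes `I, J` with `ℓ(I) ≤ ℓ(J)`. -/
theorem statement6 (n : ℕ) (hn : 0 < n) (γ : ℝ) (hγ0 : 0 < γ) (hγ1 : γ ≤ 1) :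
    ∃ C : ℝ, 0 < C ∧
      ∀ K : (Fin n → ℝ) → (Fin n → ℝ) → ℝ, IsNormalisedKernel n γ K →
      ∀ (kI kJ : ℤ) (mI mJ : Fin n → ℤ) (η : Fin n → Bool), η ≠ (fun _ => false) →
        kJ ≤ kI →
        Disjoint (dyadicCube n kI mI) (dyadicCube n kJ mJ) →
        ((sideLen kJ ≤ setDist (dyadicCube n kI mI) (dyadicCube n kJ mJ) →
          |pairing (haarZero n kJ mJ) (czIntegral K (haarFn n kI mI η))| ≤
            C * (sideLen kI / sideLen kJ) ^ ((n:ℝ)/2) *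
              (sideLen kI ^ γ * sideLen kJ ^ (n:ℝ) *
                setDist (dyadicCube n kI mI) (dyadicCube n kJ mJ) ^ (-(n:ℝ) - γ))) ∧
        (sideLen kI ≤ setDist (dyadicCube n kI mI) (dyadicCube n kJ mJ) →
          setDist (dyadicCube n kI mI) (dyadicCube n kJ mJ) ≤ sideLen kJ →
          |pairing (haarZero n kJ mJ) (czIntegral K (haarFn n kI mI η))| ≤
            C * (sideLen kI / sideLen kJ) ^ ((n:ℝ)/2) *
              (sideLen kI ^ γ *
                setDist (dyadicCube n kI mI) (frontier (dyadicCube n kJ mJ)) ^ (-γ))) ∧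
        (setDist (dyadicCube n kI mI) (dyadicCube n kJ mJ) ≤ sideLen kI →
          |pairing (haarZero n kJ mJ) (czIntegral K (haarFn n kI mI η))| ≤
            C * (sideLen kI / sideLen kJ) ^ ((n:ℝ)/2))) := by
  obtain ⟨C₁, hC₁, hfar⟩ := exists_majorant_far (Fin n → ℝ) (s := n + γ) (by simpa using hγ0)
  obtain ⟨C₂, hC₂, hnear⟩ := exists_abs_czIntegral_haarFn_le hn
  obtain ⟨C₃, hC₃, hplane⟩ := exists_majorant_hyperplane (n := n)
  refine ⟨1 + C₁ + C₂ * C₃ * 2 ^ n, by positivity, ?_⟩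
  intro K hK kI kJ mI mJ η hη _ hdisj
  have ha := sideLen_pos kI
  have hb := sideLen_pos kJ
  rw [div_rpow_natCast_half ha hb,
    setDist_frontier_eq ⟨_, cubeCenter_mem n kI mI⟩ ⟨_, cubeCenter_mem n kJ mJ⟩ hdisj]
  have hsqa : sideLen kI ^ n = √(sideLen kI) ^ n * √(sideLen kI) ^ n := by
    rw [← mul_pow, Real.mul_self_sqrt ha.le]
  set a := sideLen kI
  set b := sideLen kJ
  set d := setDist (dyadicCube n kI mI) (dyadicCube n kJ mJ)
  set c := cubeCenter n kI mI with hc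
  have hdc : ∀ x ∈ dyadicCube n kJ mJ, d ≤ dist x c := fun x hx => by
    rw [dist_comm]
    exact setDist_le_dist (cubeCenter_mem n kI mI) hx
  have hexp : (Module.finrank ℝ (Fin n → ℝ) : ℝ) - (n + γ) = -γ := by simp
  have hexp' : -((n:ℝ) + γ) = -(n:ℝ) - γ := by ring
  rw [hexp] at hfar
  rw [hexp'] at hfar
  have hC1 : 1 ≤ 1 + C₁ + C₂ * C₃ * 2 ^ n := by
    have : 0 ≤ C₂ * C₃ * 2 ^ n := by positivity
    linarith
  have hC1' : C₁ ≤ 1 + C₁ + C₂ * C₃ * 2 ^ n := by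
    have : 0 ≤ C₂ * C₃ * 2 ^ n := by positivity
    linarith
  refine ⟨fun hd => ?_, fun hd _ => ?_, fun _ => ?_⟩
  · have hab : a ≤ b := by
      change (2:ℝ) ^ (-kI) ≤ (2:ℝ) ^ (-kJ)
      exact zpow_le_zpow_right₀ (by norm_num) (by omega)
    have hd0 : 0 < d := hb.trans_le hd
    have hmain := abs_pairing_haarZero_le (F := czIntegral K (haarFn n kI mI η))
      (integrable_indicator_dyadicCube n kJ mJ (√a ^ n * a ^ γ * d ^ (-(n:ℝ) - γ)))
      (Set.indicator_nonneg fun _ _ => by positivity) (k := kJ) (m := mJ)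
      (ae_of_all _ fun x hx => by
        rw [Set.indicator_of_mem hx]
        refine (abs_czIntegral_haarFn_le hγ0 hK hη
          (sideLen_lt_dist_cubeCenter (hab.trans hd) hx)).trans ?_
        refine mul_le_mul_of_nonneg_left ?_ (by positivity)
        exact Real.rpow_le_rpow_of_nonpos hd0 (hdc x hx)
          (by linarith [(Nat.cast_nonneg n : (0:ℝ) ≤ n)]))
    rw [integral_indicator_dyadicCube] at hmain
    refine hmain.trans ?_
    rw [Real.rpow_natCast]
    calc _ = 1 * (√a ^ n * (√b ^ n)⁻¹) * (a ^ γ * b ^ n * d ^ (-(n:ℝ) - γ)) := by ring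
      _ ≤ _ := by gcongr
  · have hd0 : 0 < d := ha.trans_le hd
    obtain ⟨G, hGint, hG0, hGle, hGC⟩ := hfar d hd0 c
    have hmain := abs_pairing_haarZero_le (F := czIntegral K (haarFn n kI mI η))
      (hGint.const_mul (√a ^ n * a ^ γ)) (fun x => mul_nonneg (by positivity) (hG0 x))
      (k := kJ) (m := mJ)
      (ae_of_all _ fun x hx => (abs_czIntegral_haarFn_le hγ0 hK hη
          (sideLen_lt_dist_cubeCenter hd hx)).trans
        (mul_le_mul_of_nonneg_left (hGle x (hdc x hx)) (by positivity)))
    rw [integral_const_mul] at hmain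
    refine hmain.trans ?_
    calc _ ≤ (√b ^ n)⁻¹ * (√a ^ n * a ^ γ * (C₁ * d ^ (-γ))) := by gcongr
      _ = C₁ * (√a ^ n * (√b ^ n)⁻¹) * (a ^ γ * d ^ (-γ)) := by ring
      _ ≤ _ := by gcongr
  · obtain ⟨i, s, hsep⟩ := exists_separating_hyperplane hdisj
    obtain ⟨G, hGint, hG0, hGle, hGC⟩ := hfar a ha c
    obtain ⟨H, hHint, hH0, hHle, hHC⟩ := hplane a ha c i s
    have hmain := abs_pairing_haarZero_le (F := czIntegral K (haarFn n kI mI η))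
      ((hGint.const_mul (√a ^ n * a ^ γ)).add
        (hHint.const_mul (C₂ * (√a ^ n)⁻¹ * (2 * a) ^ (1 / 2 : ℝ))))
      (fun x => add_nonneg (mul_nonneg (by positivity) (hG0 x))
        (mul_nonneg (by positivity) (hH0 x)))
      (k := kJ) (m := mJ) (by
        filter_upwards [Measure.ae_eval_ne (fun _ : Fin n => (volume : Measure ℝ)) i s]
          with x hxs hx
        simp only [Pi.add_apply]
        rcases lt_or_ge a (dist x c) with hlt | hge
        · refine le_add_of_le_of_nonneg ?_ (mul_nonneg (by positivity) (hH0 x))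
          exact (abs_czIntegral_haarFn_le hγ0 hK hη hlt).trans
            (mul_le_mul_of_nonneg_left (hGle x hlt.le) (by positivity))
        · refine le_add_of_nonneg_of_le (mul_nonneg (by positivity) (hG0 x)) ?_
          refine (hnear γ K hK kI mI η x i s hge hxs fun y hy => hsep y hy x hx).trans ?_
          refine mul_le_mul_of_nonneg_left (hHle x hge ?_) (by positivity)
          refine (hsep c (cubeCenter_mem n kI mI) x hx).trans ?_
          rw [← Real.dist_eq]
          exact (dist_le_pi_dist x c i).trans hge)
    have hadd := integral_add (hGint.const_mul (√a ^ n * a ^ γ))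
      (hHint.const_mul (C₂ * (√a ^ n)⁻¹ * (2 * a) ^ (1 / 2 : ℝ)))
    simp only [Pi.add_apply] at hmain
    rw [hadd, integral_const_mul, integral_const_mul] at hmain
    refine hmain.trans ?_
    have hγa : a ^ γ * a ^ (-γ) = 1 := by
      rw [← Real.rpow_add ha, add_neg_cancel, Real.rpow_zero]
    have h2a : (2 * a) ^ (1 / 2 : ℝ) * (2 * a) ^ (1 / 2 : ℝ) * (2 * a) ^ (n - 1) =
        2 ^ n * (√a ^ n * √a ^ n) := by
      rw [← Real.rpow_add (by positivity), add_halves, Real.rpow_one, ← pow_succ',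
        Nat.sub_add_cancel hn, mul_pow, hsqa]
    have hA : (√a ^ n)⁻¹ * √a ^ n = 1 := inv_mul_cancel₀ (by positivity)
    calc _ ≤ (√b ^ n)⁻¹ * (√a ^ n * a ^ γ * (C₁ * a ^ (-γ)) +
          C₂ * (√a ^ n)⁻¹ * (2 * a) ^ (1 / 2 : ℝ) *
            (C₃ * (2 * a) ^ (n - 1) * (2 * a) ^ (1 / 2 : ℝ))) := by gcongr
      _ = (√b ^ n)⁻¹ * (√a ^ n * C₁ * (a ^ γ * a ^ (-γ)) + C₂ * C₃ * (√a ^ n)⁻¹ *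
            ((2 * a) ^ (1 / 2 : ℝ) * (2 * a) ^ (1 / 2 : ℝ) * (2 * a) ^ (n - 1))) := by ring
      _ = (√b ^ n)⁻¹ * (√a ^ n * C₁ + C₂ * C₃ * 2 ^ n * √a ^ n * ((√a ^ n)⁻¹ * √a ^ n)) := by
        rw [hγa, h2a]; ring
      _ = (C₁ + C₂ * C₃ * 2 ^ n) * (√a ^ n * (√b ^ n)⁻¹) := by rw [hA]; ring
      _ ≤ _ := by gcongr; linarith

end
end
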